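/- arXiv:1907.09599 — 4 statements merged into one kernel-verified Lean document; each statement's English description precedes it below -/
import Mathlib

section
/- Let T be a densely defined linear operator in H. If dom(T) ∩ dom(T*) is dense in H, or if W(T) ≠ ℂ, then W_{e1}(T) = W_{e2}(T) = W_{e3}(T) = W_{e4}(T) = W_e(T). -/
open Filter Topology

noncomputable section

variable {H : Type*} [NormedAddCommGroup H] [InnerProductSpace ℂ H] [CompleteSpace H]

/-- A sequence in an inner product space converges weakly to zero. -/
def WeakNull {E : Type*} [NormedAddCommGroup E] [InnerProductSpace ℂ E] (x : ℕ → E) : Prop :=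
  ∀ y : E, Tendsto (fun n => (inner ℂ (x n) y : ℂ)) atTop (nhds 0)

/-- The numerical range of a (possibly unbounded) linear operator `T` in `H`,
`W(T) = {⟨Tx, x⟩ : x ∈ dom T, ‖x‖ = 1}`. -/
def numRange (T : H →ₗ.[ℂ] H) : Set ℂ :=
  {z | ∃ x : T.domain, ‖(x : H)‖ = 1 ∧ (inner ℂ ((x : H)) (T x) : ℂ) = z}

/-- The essential numerical range of a (possibly unbounded) linear operator `T` in `H`. -/
def essNumRange (T : H →ₗ.[ℂ] H) : Set ℂ :=
  {z | ∃ x : ℕ → T.domain, (∀ n, ‖((x n : H))‖ = 1) ∧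
    WeakNull (fun n => ((x n : H))) ∧
    Tendsto (fun n => (inner ℂ ((x n : H)) (T (x n)) : ℂ)) atTop (nhds z)}

/-- The essential spectrum `σ_e(T)` (the version `σ_{e2}` via singular Weyl sequences). -/
def essSpec (T : H →ₗ.[ℂ] H) : Set ℂ :=
  {z | ∃ x : ℕ → T.domain, (∀ n, ‖((x n : H))‖ = 1) ∧
    WeakNull (fun n => ((x n : H))) ∧
    Tendsto (fun n => ‖T (x n) - z • ((x n : H))‖) atTop (nhds 0)}

/-- The sum `T + K` of a linear operator `T` in `H` and a bounded operator `K` on `H`,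
with domain `dom T`. -/
def pmapAddCLM (T : H →ₗ.[ℂ] H) (K : H →L[ℂ] H) : H →ₗ.[ℂ] H :=
  { domain := T.domain
    toFun := T.toFun + (K : H →ₗ[ℂ] H).comp T.domain.subtype }

/-- `W_{e1}(T)`: intersection over all finite-dimensional subspaces `V ⊆ H` of the
closure of `W(T|_{V^⊥ ∩ dom T})`. -/
def We1 (T : H →ₗ.[ℂ] H) : Set ℂ :=
  ⋂ (V : Submodule ℂ H) (_ : FiniteDimensional ℂ V),
    closure (numRange (T.domRestrict Vᗮ))

/-- `W_{e2}(T)`: intersection over all bounded finite-rank operators `K`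
of the closure of `W(T + K)`. -/
def We2 (T : H →ₗ.[ℂ] H) : Set ℂ :=
  ⋂ (K : H →L[ℂ] H) (_ : FiniteDimensional ℂ (LinearMap.range (K : H →ₗ[ℂ] H))),
    closure (numRange (pmapAddCLM T K))

/-- `W_{e3}(T)`: intersection over all compact bounded operators `K`
of the closure of `W(T + K)`. -/
def We3 (T : H →ₗ.[ℂ] H) : Set ℂ :=
  ⋂ (K : H →L[ℂ] H) (_ : IsCompactOperator fun x : H => K x),
    closure (numRange (pmapAddCLM T K))

/-- `W_{e4}(T)`: the set of limits of `⟨T e_n, e_n⟩` along orthonormal sequences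
`(e_n) ⊆ dom T`. -/
def We4 (T : H →ₗ.[ℂ] H) : Set ℂ :=
  {z | ∃ e : ℕ → T.domain, Orthonormal ℂ (fun n => ((e n : H))) ∧
    Tendsto (fun n => (inner ℂ ((e n : H)) (T (e n)) : ℂ)) atTop (nhds z)}

set_option linter.unusedSectionVars false
set_option linter.unusedSimpArgs false

/-- The sesquilinear form of `T`. -/
def bform (T : H →ₗ.[ℂ] H) (x y : T.domain) : ℂ := inner ℂ (x : H) (T y)

lemma bform_add_left (T : H →ₗ.[ℂ] H) (x y z : T.domain) :
    bform T (x + y) z = bform T x z + bform T y z := by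
  simp [bform, inner_add_left]

lemma bform_add_right (T : H →ₗ.[ℂ] H) (x y z : T.domain) :
    bform T x (y + z) = bform T x y + bform T x z := by
  simp [bform, inner_add_right, T.map_add]

lemma bform_sub_left (T : H →ₗ.[ℂ] H) (x y z : T.domain) :
    bform T (x - y) z = bform T x z - bform T y z := by
  simp [bform, inner_sub_left]

lemma bform_sub_right (T : H →ₗ.[ℂ] H) (x y z : T.domain) :
    bform T x (y - z) = bform T x y - bform T x z := by
  simp [bform, inner_sub_right, T.map_sub]

lemma bform_smul_left (T : H →ₗ.[ℂ] H) (x y : T.domain) (r : ℂ) :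
    bform T (r • x) y = (starRingEnd ℂ) r * bform T x y := by
  simp only [bform, Submodule.coe_smul, inner_smul_left]

lemma bform_smul_right (T : H →ₗ.[ℂ] H) (x y : T.domain) (r : ℂ) :
    bform T x (r • y) = r * bform T x y := by
  simp [bform, inner_smul_right, T.map_smul]

lemma numRange_of_ne (T : H →ₗ.[ℂ] H) (x : T.domain) (hx : (x : H) ≠ 0) :
    bform T x x / (‖(x : H)‖ : ℂ) ^ 2 ∈ numRange T := by
  have h0 : ‖(x : H)‖ ≠ 0 := norm_ne_zero_iff.mpr hx
  have h0' : (‖(x : H)‖ : ℂ) ≠ 0 := by exact_mod_cast h0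
  refine ⟨((‖(x : H)‖ : ℂ)⁻¹) • x, ?_, ?_⟩
  · simp [norm_smul, h0]
  · change bform T _ _ = _
    rw [bform_smul_left, bform_smul_right]
    simp
    field_simp

lemma numRange_convex (T : H →ₗ.[ℂ] H) : Convex ℝ (numRange T) := by
  rw [convex_iff_forall_pos]
  rintro a ⟨x, hx, hxa⟩ b ⟨y, hy, hyb⟩ p t hp ht hpt
  change bform T x x = a at hxa
  change bform T y y = b at hyb
  by_cases hab : a = b
  · subst hab
    rw [← add_smul, hpt, one_smul]
    exact ⟨x, hx, hxa⟩
  have hba : b - a ≠ 0 := sub_ne_zero.mpr (Ne.symm hab)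
  set c1 : ℂ := (bform T x y - a * inner ℂ (x : H) (y : H)) / (b - a) with hc1
  set c2 : ℂ := (bform T y x - a * inner ℂ (y : H) (x : H)) / (b - a) with hc2
  obtain ⟨u, hu, huw⟩ := RCLike.exists_norm_eq_mul_self (c1 - (starRingEnd ℂ) c2)
  have huu : (starRingEnd ℂ) u * u = 1 := by
    rw [mul_comm, Complex.mul_conj, Complex.normSq_eq_norm_sq, hu]; simp
  have him : (u * c1 + (starRingEnd ℂ) u * c2).im = 0 := by
    have := congrArg Complex.im huw
    simp [Complex.mul_im] at this ⊢
    linarith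
  obtain ⟨g, hg⟩ : ∃ g : ℝ, u * c1 + (starRingEnd ℂ) u * c2 = (g : ℂ) :=
    ⟨(u * c1 + (starRingEnd ℂ) u * c2).re, Complex.ext (by simp) (by rw [him]; simp)⟩
  let z : ℝ → T.domain := fun s => ((1 - s : ℝ) : ℂ) • x + ((s : ℂ) * u) • y
  have hBz : ∀ s, bform T (z s) (z s) =
      a * (‖(z s : H)‖ : ℂ) ^ 2 + (b - a) * ((s ^ 2 + s * (1 - s) * g : ℝ) : ℂ) := by
    intro s
    have hn : (‖(z s : H)‖ : ℂ) ^ 2 = inner ℂ (z s : H) (z s : H) := by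
      rw [inner_self_eq_norm_sq_to_K]; rfl
    have e1 : inner ℂ (x : H) (x : H) = (1 : ℂ) := by
      rw [inner_self_eq_norm_sq_to_K, hx]; simp
    have e2 : inner ℂ (y : H) (y : H) = (1 : ℂ) := by
      rw [inner_self_eq_norm_sq_to_K, hy]; simp
    have hg' : (b - a) * (g : ℂ) = u * (bform T x y - a * inner ℂ (x : H) (y : H)) +
        (starRingEnd ℂ) u * (bform T y x - a * inner ℂ (y : H) (x : H)) := by
      rw [← hg, hc1, hc2]; field_simp
    rw [hn]
    simp only [z, bform_add_left, bform_add_right, bform_smul_left, bform_smul_right,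
      Submodule.coe_add, Submodule.coe_smul, inner_add_left, inner_add_right, inner_smul_left,
      inner_smul_right, hxa, hyb, e1, e2, map_mul, Complex.conj_ofReal]
    push_cast
    linear_combination (s ^ 2 * b - a * s ^ 2) * huu - s * (1 - s) * hg'
  have hz0 : ∀ s, (z s : H) ≠ 0 := by
    intro s hs
    have hs1 : ((1 - s : ℝ) : ℂ) • x = (-((s : ℂ) * u)) • y := by
      rw [neg_smul]
      exact eq_neg_of_add_eq_zero_left (by ext; exact hs)
    have hs2 := congrArg (fun v : T.domain => ‖(v : H)‖) hs1
    have hs3 := congrArg (fun v : T.domain => bform T v v) hs1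
    simp only [Submodule.coe_smul, norm_smul, hx, hy, norm_neg, norm_mul, hu, mul_one,
      Complex.norm_real, Real.norm_eq_abs] at hs2
    simp only [bform_smul_left, bform_smul_right, hxa, hyb, map_neg, map_mul,
      Complex.conj_ofReal] at hs3
    have hsq : (1 - s) ^ 2 = s ^ 2 := by rw [← sq_abs, hs2, sq_abs]
    have hs5 : s = 1 / 2 := by nlinarith
    subst hs5
    apply hab
    push_cast at hs3
    linear_combination 4 * hs3 + b * huu
  have hcont : Continuous fun s => (s ^ 2 + s * (1 - s) * g) / ‖(z s : H)‖ ^ 2 := by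
    refine Continuous.div (by fun_prop) ?_ fun s => by simpa using hz0 s
    simp only [z, Submodule.coe_add, Submodule.coe_smul]
    fun_prop
  have hivt := intermediate_value_Icc (zero_le_one (α := ℝ)) hcont.continuousOn
  have hz1 : ‖(z 1 : H)‖ = 1 := by simp [z, norm_smul, hu, hy]
  simp only [hz1] at hivt
  obtain ⟨s, -, hs⟩ := hivt (show t ∈ _ by simp; constructor <;> linarith)
  have hmem := numRange_of_ne T (z s) (hz0 s)
  have hnz : (‖(z s : H)‖ : ℂ) ≠ 0 := by simpa using hz0 s
  convert hmem using 1
  rw [hBz, ← hs]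
  have hp' : p = 1 - t := by linarith
  rw [hp', ← hs]
  simp only [Complex.real_smul]
  push_cast
  field_simp
  ring

lemma halfplane_of_numRange_ne (T : H →ₗ.[ℂ] H) (h : numRange T ≠ Set.univ) :
    closure (numRange T) ≠ Set.univ := by
  intro hc
  apply h
  have hconv := numRange_convex T
  have hspan : affineSpan ℝ (numRange T) = ⊤ := by
    have h1 : closure (numRange T) ⊆ (affineSpan ℝ (numRange T) : Set ℂ) :=
      closure_minimal (subset_affineSpan ℝ _) (AffineSubspace.closed_of_finiteDimensional _)
    rw [hc] at h1
    exact SetLike.coe_injective (by simpa using h1)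
  have hint := hconv.interior_nonempty_iff_affineSpan_eq_top.mpr hspan
  have := hconv.interior_closure_eq_interior_of_nonempty_interior hint
  rw [hc, interior_univ] at this
  exact Set.eq_univ_of_univ_subset (this.le.trans interior_subset)

/-- Separation in the plane. -/
lemma sep_plane (S : Set ℂ) (hS : Convex ℝ S) (z : ℂ) (hz : z ∉ closure S) :
    ∃ ν : ℂ, ν ≠ 0 ∧ ∃ s : ℝ, (ν * z).re < s ∧ ∀ w ∈ S, s ≤ (ν * w).re := by
  rcases S.eq_empty_or_nonempty with rfl | ⟨w0, hw0⟩
  · exact ⟨1, one_ne_zero, z.re + 1, by simp, by simp⟩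
  obtain ⟨f, u, h1, h2⟩ := RCLike.geometric_hahn_banach_point_closed (𝕜 := ℂ) hS.closure
    isClosed_closure hz
  have hf : ∀ w, f w = f 1 * w := fun w => by
    have := f.map_smul w 1
    simp only [smul_eq_mul, mul_one] at this
    rw [this, mul_comm]
  refine ⟨f 1, ?_, u, ?_, ?_⟩
  · intro h0
    have h3 := h2 w0 (subset_closure hw0)
    rw [hf, h0] at h1 h3
    simp at h1 h3
    linarith
  · rw [← hf]; exact h1
  · intro w hw
    rw [← hf]; exact (h2 w (subset_closure hw)).le

lemma compact_weakNull (K : H →L[ℂ] H) (hK : IsCompactOperator fun x : H => K x)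
    (x : ℕ → H) (hx : ∀ n, ‖x n‖ = 1) (hw : WeakNull x) :
    Tendsto (fun n => K (x n)) atTop (nhds 0) := by
  have hK' : IsCompactOperator (K : H →ₗ[ℂ] H) := hK
  obtain ⟨C, hC, hCs⟩ := hK'.image_closedBall_subset_compact 1
  have hmem : ∀ n, K (x n) ∈ C := fun n => hCs ⟨x n, by simp [hx n], rfl⟩
  apply tendsto_of_subseq_tendsto
  intro ns hns
  obtain ⟨y, -, φ, hφ, hlim⟩ := hC.tendsto_subseq (x := fun n => K (x (ns n)))
    (fun n => hmem _)
  refine ⟨φ, ?_⟩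
  have hy : y = 0 := by
    have h1 : Tendsto (fun n => inner ℂ (K (x (ns (φ n)))) y) atTop (nhds (inner ℂ y y)) :=
      Filter.Tendsto.inner hlim tendsto_const_nhds
    have h2 : Tendsto (fun n => inner ℂ (K (x (ns (φ n)))) y) atTop (nhds 0) := by
      have h3 := ((hw (ContinuousLinearMap.adjoint K y)).comp hns).comp hφ.tendsto_atTop
      refine h3.congr fun n => ?_
      simp [ContinuousLinearMap.adjoint_inner_right]
    exact inner_self_eq_zero.mp (tendsto_nhds_unique h1 h2)
  rw [← hy]
  exact hlim

lemma finiteRank_compact (K : H →L[ℂ] H)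
    (hK : FiniteDimensional ℂ (LinearMap.range (K : H →ₗ[ℂ] H))) :
    IsCompactOperator fun x : H => K x := by
  have : ProperSpace (LinearMap.range (K : H →ₗ[ℂ] H)) := FiniteDimensional.proper ℂ _
  refine ⟨Subtype.val '' (Metric.closedBall (0 : LinearMap.range (K : H →ₗ[ℂ] H)) ‖K‖),
    (isCompact_closedBall _ _).image continuous_subtype_val, ?_⟩
  refine Filter.mem_of_superset (Metric.closedBall_mem_nhds (0 : H) one_pos) ?_
  intro x hx
  refine ⟨⟨K x, x, rfl⟩, ?_, rfl⟩
  simp only [mem_closedBall_zero_iff] at hx ⊢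
  exact (K.le_opNorm_of_le hx).trans (by simp)

lemma We4_subset (T : H →ₗ.[ℂ] H) : We4 T ⊆ essNumRange T := by
  rintro z ⟨e, he, hlim⟩
  refine ⟨e, fun n => he.1 n, fun y => ?_, hlim⟩
  have h1 := (he.inner_products_summable (x := y)).tendsto_atTop_zero
  rw [tendsto_zero_iff_norm_tendsto_zero]
  have h2 := h1.sqrt
  simpa using h2

lemma ess_subset_We3 (T : H →ₗ.[ℂ] H) : essNumRange T ⊆ We3 T := by
  rintro z ⟨x, hx, hw, hlim⟩
  simp only [We3, Set.mem_iInter]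
  intro K hK
  have hKx := compact_weakNull K hK _ hx hw
  have h0 : Tendsto (fun n => inner ℂ (x n : H) (K (x n))) atTop (nhds 0) := by
    apply squeeze_zero_norm (fun n => ?_) (tendsto_zero_iff_norm_tendsto_zero.mp hKx)
    exact (norm_inner_le_norm _ _).trans (by simp [hx n])
  have hs := hlim.add h0
  rw [add_zero] at hs
  refine mem_closure_of_tendsto hs (Eventually.of_forall fun n => ?_)
  refine ⟨x n, hx n, ?_⟩
  rw [← inner_add_right]
  rfl

lemma We3_subset_We2 (T : H →ₗ.[ℂ] H) : We3 T ⊆ We2 T := by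
  intro z hz
  simp only [We3, We2, Set.mem_iInter] at hz ⊢
  exact fun K hK => hz K (finiteRank_compact K hK)

lemma mem_numRange_domRestrict (T : H →ₗ.[ℂ] H) (S : Submodule ℂ H) (z : ℂ) :
    z ∈ numRange (T.domRestrict S) ↔
      ∃ x : T.domain, (x : H) ∈ S ∧ ‖(x : H)‖ = 1 ∧ bform T x x = z := by
  constructor
  · rintro ⟨x, hx, hz⟩
    refine ⟨⟨x, x.2.2⟩, x.2.1, hx, ?_⟩
    exact hz
  · rintro ⟨x, hxS, hx, hz⟩
    exact ⟨⟨x, hxS, x.2⟩, hx, hz⟩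

lemma We1_subset_We4 (T : H →ₗ.[ℂ] H) : We1 T ⊆ We4 T := by
  intro z hz
  simp only [We1, Set.mem_iInter] at hz
  obtain ⟨f, hf, hr⟩ := exists_seq_of_forall_finset_exists
    (fun p : ℕ × T.domain => ‖(p.2 : H)‖ = 1 ∧ dist (bform T p.2 p.2) z < 1 / ((p.1 : ℝ) + 1))
    (fun p q => p.1 < q.1 ∧ inner ℂ (p.2 : H) (q.2 : H) = 0) (by
      intro s _
      classical
      let V : Submodule ℂ H := Submodule.span ℂ ((s.image fun p => (p.2 : H) : Finset H) : Set H)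
      have hV : FiniteDimensional ℂ V := FiniteDimensional.span_finset ℂ _
      obtain ⟨N, hN⟩ : ∃ N : ℕ, ∀ p ∈ s, p.1 < N :=
        ⟨s.sup (fun p => p.1) + 1, fun p hp => Nat.lt_succ_of_le (Finset.le_sup (f := fun p => p.1) hp)⟩
      obtain ⟨w, hw, hd⟩ := Metric.mem_closure_iff.mp (hz V hV) (1 / ((N : ℝ) + 1)) (by positivity)
      obtain ⟨x, hxV, hx, rfl⟩ := (mem_numRange_domRestrict _ _ _).mp hw
      refine ⟨(N, x), ⟨hx, by rw [dist_comm]; exact hd⟩, fun p hp => ⟨hN p hp, ?_⟩⟩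
      exact (Submodule.mem_orthogonal _ _).mp hxV _ (Submodule.subset_span (by
        simp only [Finset.coe_image]
        exact ⟨p, hp, rfl⟩)))
  have hmono : StrictMono fun n => (f n).1 := fun m n h => (hr m n h).1
  refine ⟨fun n => (f n).2, ⟨fun n => (hf n).1, ?_⟩, ?_⟩
  · intro m n hmn
    rcases lt_or_gt_of_ne hmn with h | h
    · exact (hr m n h).2
    · exact inner_eq_zero_symm.mp (hr n m h).2
  · rw [tendsto_iff_dist_tendsto_zero]
    refine squeeze_zero (fun _ => dist_nonneg) (fun n => (hf n).2.le) ?_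
    exact (tendsto_one_div_add_atTop_nhds_zero_nat (𝕜 := ℝ)).comp hmono.tendsto_atTop

/-- A finite-dimensional correction into a dense subspace. -/
lemma exists_correction (E : Submodule ℂ H) (hE : Dense (E : Set H)) (V : Submodule ℂ H)
    [FiniteDimensional ℂ V] :
    ∃ S : V →ₗ[ℂ] E, ∀ x : H, x - (S (V.orthogonalProjectionOnto x) : H) ∈ Vᗮ := by
  let P : E →ₗ[ℂ] V := (V.orthogonalProjectionOnto : H →ₗ[ℂ] V).comp E.subtype
  have hsurj : Function.Surjective P := by
    rw [← LinearMap.range_eq_top]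
    have hd : Dense (LinearMap.range P : Set V) := by
      have h1 : DenseRange (V.orthogonalProjectionOnto : H → V) := by
        apply Function.Surjective.denseRange
        intro v
        exact ⟨v, by simp⟩
      have h2 := h1.dense_image V.orthogonalProjectionOnto.continuous hE
      refine h2.mono ?_
      rintro _ ⟨e, he, rfl⟩
      exact ⟨⟨e, he⟩, rfl⟩
    have hc : IsClosed (LinearMap.range P : Set V) := Submodule.closed_of_finiteDimensional _
    apply SetLike.coe_injective
    rw [← hc.closure_eq, hd.closure_eq]; rfl
  obtain ⟨S, hS⟩ := P.exists_rightInverse_of_surjective (LinearMap.range_eq_top.mpr hsurj)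
  refine ⟨S, fun x => ?_⟩
  rw [← Submodule.orthogonalProjectionOnto_eq_zero_iff, map_sub, sub_eq_zero]
  exact (LinearMap.congr_fun hS (V.orthogonalProjectionOnto x)).symm

/-- The quadratic form `Re (μ ⟨Ty, y⟩) + c ‖y‖²`. -/
def pf (T : H →ₗ.[ℂ] H) (μ : ℂ) (c : ℝ) (y : T.domain) : ℝ :=
  (μ * bform T y y).re + c * ‖(y : H)‖ ^ 2

/-- The Hermitian form polarizing `pf`. -/
def af (T : H →ₗ.[ℂ] H) (μ : ℂ) (c : ℝ) (x y : T.domain) : ℂ :=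
  (μ * bform T x y + (starRingEnd ℂ) (μ * bform T y x)) / 2 + c * inner ℂ (x : H) (y : H)

lemma af_self (T : H →ₗ.[ℂ] H) (μ : ℂ) (c : ℝ) (y : T.domain) :
    (af T μ c y y).re = pf T μ c y := by
  have h : inner ℂ (y : H) (y : H) = ((‖(y : H)‖ ^ 2 : ℝ) : ℂ) := by
    rw [inner_self_eq_norm_sq_to_K]; simp
  rw [af, pf, h, Complex.add_conj, ← Complex.ofReal_mul, Complex.add_re, Complex.ofReal_re]
  simp

lemma af_cauchy (T : H →ₗ.[ℂ] H) (μ : ℂ) (c : ℝ) (hp : ∀ y, 0 ≤ pf T μ c y) (x y : T.domain) :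
    ‖af T μ c x y‖ ≤ √(pf T μ c x) * √(pf T μ c y) := by
  have hsymm : ∀ x y : T.domain, (starRingEnd ℂ) (af T μ c y x) = af T μ c x y := by
    intro x y
    simp only [af, map_add, map_div₀, map_mul, Complex.conj_conj, Complex.conj_ofReal,
      inner_conj_symm, map_ofNat]
    ring
  let core : PreInnerProductSpace.Core ℂ T.domain :=
    { inner := af T μ c
      conj_inner_symm := hsymm
      re_inner_nonneg := fun x => by
        have := hp x
        rw [← af_self] at this
        exact this
      add_left := fun x y z => by
        simp only [af, bform_add_left, bform_add_right, map_add, map_mul, Submodule.coe_add,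
          inner_add_left]
        ring
      smul_left := fun x y r => by
        simp only [af, bform_smul_left, bform_smul_right, map_mul, Submodule.coe_smul,
          inner_smul_left]
        ring }
  have h := @InnerProductSpace.Core.inner_mul_inner_self_le ℂ T.domain _ _ _ core x y
  change ‖af T μ c x y‖ * ‖af T μ c y x‖ ≤ (af T μ c x x).re * (af T μ c y y).re at h
  rw [af_self, af_self] at h
  have h2 : ‖af T μ c y x‖ = ‖af T μ c x y‖ := by rw [← hsymm x y, RCLike.norm_conj]
  rw [h2] at h
  rw [← Real.sqrt_mul (hp x)]
  apply Real.le_sqrt_of_sq_le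
  rw [sq]; exact h

lemma key (T : H →ₗ.[ℂ] H) (hdense : Dense (T.domain : Set H))
    (h : Dense ((T.domain ⊓ T.adjoint.domain : Submodule ℂ H) : Set H) ∨
      numRange T ≠ Set.univ) :
    ∃ (μ : ℂ) (c : ℝ), (∀ y, 0 ≤ pf T μ c y) ∧
      ∀ (V : Submodule ℂ H) [FiniteDimensional ℂ V], ∃ g : H → T.domain,
        (∀ x, x - (g x : H) ∈ Vᗮ) ∧ ∃ C : ℝ, 0 ≤ C ∧ ∀ x : H,
          ‖(g x : H)‖ ≤ C * ‖V.starProjection x‖ ∧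
          ‖T (g x)‖ ≤ C * ‖V.starProjection x‖ ∧
          ∀ y : T.domain, ‖bform T (g x) y‖ ≤
            C * ‖V.starProjection x‖ * (√(pf T μ c y) + ‖(y : H)‖) := by
  have hnP : ∀ (V : Submodule ℂ H) [FiniteDimensional ℂ V] (x : H),
      ‖V.starProjection x‖ = ‖V.orthogonalProjectionOnto x‖ := fun V _ x => rfl
  rcases h with h | h
  · refine ⟨0, 0, by simp [pf], fun V _ => ?_⟩
    obtain ⟨S, hS⟩ := exists_correction _ h V
    let S1 : V →ₗ[ℂ] T.domain := (Submodule.inclusion inf_le_left).comp S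
    let S2 : V →ₗ[ℂ] T.adjoint.domain := (Submodule.inclusion inf_le_right).comp S
    let L0 : V →L[ℂ] H := LinearMap.toContinuousLinearMap (T.domain.subtype.comp S1)
    let L1 : V →L[ℂ] H := LinearMap.toContinuousLinearMap (T.toFun.comp S1)
    let L2 : V →L[ℂ] H := LinearMap.toContinuousLinearMap (T.adjoint.toFun.comp S2)
    refine ⟨fun x => S1 (V.orthogonalProjectionOnto x), hS, ‖L0‖ + ‖L1‖ + ‖L2‖, by positivity,
      fun x => ?_⟩
    rw [hnP]
    set v := V.orthogonalProjectionOnto x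
    refine ⟨(L0.le_opNorm v).trans ?_, (L1.le_opNorm v).trans ?_, fun y => ?_⟩
    · gcongr; linarith [norm_nonneg L1, norm_nonneg L2]
    · gcongr; linarith [norm_nonneg L0, norm_nonneg L2]
    · have h1 : bform T (S1 v) y = inner ℂ (L2 v) (y : H) :=
        ((LinearPMap.adjoint_isFormalAdjoint hdense) (S2 v) y).symm
      rw [h1]
      have h2 : ‖L2 v‖ ≤ (‖L0‖ + ‖L1‖ + ‖L2‖) * ‖v‖ := by
        refine (L2.le_opNorm v).trans ?_
        gcongr; linarith [norm_nonneg L0, norm_nonneg L1]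
      refine (norm_inner_le_norm _ _).trans ?_
      have := Real.sqrt_nonneg (pf T 0 0 y)
      gcongr
      linarith
  · have hne := halfplane_of_numRange_ne T h
    obtain ⟨z, hz⟩ := (Set.ne_univ_iff_exists_notMem _).mp hne
    obtain ⟨μ, hμ, s, -, hs⟩ := sep_plane _ (numRange_convex T) z hz
    have hp : ∀ y, 0 ≤ pf T μ (-s) y := by
      intro y
      by_cases hy : (y : H) = 0
      · have : y = 0 := by ext; simpa using hy
        subst this
        simp [pf, bform]
      have h1 := hs _ (numRange_of_ne T y hy)
      have h0 : 0 < ‖(y : H)‖ := norm_pos_iff.mpr hy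
      rw [← mul_div_assoc, ← Complex.ofReal_pow, Complex.div_ofReal_re, le_div_iff₀ (by positivity)] at h1
      rw [pf]; linarith
    refine ⟨μ, -s, hp, fun V _ => ?_⟩
    obtain ⟨S1, hS⟩ := exists_correction _ hdense V
    let L0 : V →L[ℂ] H := LinearMap.toContinuousLinearMap (T.domain.subtype.comp S1)
    let L1 : V →L[ℂ] H := LinearMap.toContinuousLinearMap (T.toFun.comp S1)
    obtain ⟨A, hA0, hA, hA'⟩ : ∃ A : ℝ, 0 ≤ A ∧ ‖L0‖ ≤ A ∧ ‖L1‖ ≤ A :=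
      ⟨max ‖L0‖ ‖L1‖, by positivity, le_max_left _ _, le_max_right _ _⟩
    obtain ⟨Q, hQ0, hQ⟩ : ∃ Q : ℝ, 0 ≤ Q ∧ ∀ v, √(pf T μ (-s) (S1 v)) ≤ Q * ‖v‖ := by
      refine ⟨√(‖μ‖ * A ^ 2 + |s| * A ^ 2), by positivity, fun v => ?_⟩
      rw [← Real.sqrt_sq (norm_nonneg v), ← Real.sqrt_mul (by positivity)]
      apply Real.sqrt_le_sqrt
      have a1 : ‖(S1 v : H)‖ ≤ A * ‖v‖ := (L0.le_opNorm v).trans (by gcongr)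
      have a2 : ‖T (S1 v)‖ ≤ A * ‖v‖ := (L1.le_opNorm v).trans (by gcongr)
      have a3 : (μ * bform T (S1 v) (S1 v)).re ≤ ‖μ‖ * ((A * ‖v‖) * (A * ‖v‖)) := by
        refine (Complex.re_le_norm _).trans ?_
        rw [norm_mul]
        gcongr
        refine (norm_inner_le_norm _ _).trans ?_
        gcongr
      have a4 : -s * ‖(S1 v : H)‖ ^ 2 ≤ |s| * (A * ‖v‖) ^ 2 := by
        have : -s ≤ |s| := neg_le_abs s
        gcongr
      rw [pf]
      nlinarith
    have hμ' : 0 < ‖μ‖ := norm_pos_iff.mpr hμ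
    set C : ℝ := A + (2 * Q + 2 * |s| * A + ‖μ‖ * A) / ‖μ‖ with hC
    have hAC : A ≤ C := by rw [hC]; have : 0 ≤ (2 * Q + 2 * |s| * A + ‖μ‖ * A) / ‖μ‖ := by positivity
                           linarith
    refine ⟨fun x => S1 (V.orthogonalProjectionOnto x), hS, C, hA0.trans hAC, fun x => ?_⟩
    rw [hnP]
    set v := V.orthogonalProjectionOnto x
    have a1 : ‖(S1 v : H)‖ ≤ A * ‖v‖ := (L0.le_opNorm v).trans (by gcongr)
    have a2 : ‖T (S1 v)‖ ≤ A * ‖v‖ := (L1.le_opNorm v).trans (by gcongr)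
    refine ⟨a1.trans (by gcongr), a2.trans (by gcongr), fun y => ?_⟩
    have e : μ * bform T (S1 v) y = 2 * af T μ (-s) (S1 v) y +
        2 * s * inner ℂ (S1 v : H) (y : H) - (starRingEnd ℂ) (μ * bform T y (S1 v)) := by
      rw [af]; push_cast; ring
    have b1 := af_cauchy T μ (-s) hp (S1 v) y
    have b2 : ‖inner ℂ (S1 v : H) (y : H)‖ ≤ A * ‖v‖ * ‖(y : H)‖ :=
      (norm_inner_le_norm _ _).trans (by gcongr)
    have b3 : ‖bform T y (S1 v)‖ ≤ ‖(y : H)‖ * (A * ‖v‖) :=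
      (norm_inner_le_norm _ _).trans (by gcongr)
    set r := √(pf T μ (-s) y) with hr
    have hr0 : 0 ≤ r := Real.sqrt_nonneg _
    have b4 : ‖af T μ (-s) (S1 v) y‖ ≤ Q * ‖v‖ * r := b1.trans (by gcongr; exact hQ v)
    have e2 : ‖μ‖ * ‖bform T (S1 v) y‖ ≤ 2 * (Q * ‖v‖ * r) + 2 * |s| * (A * ‖v‖ * ‖(y : H)‖) +
        ‖μ‖ * (‖(y : H)‖ * (A * ‖v‖)) := by
      rw [← norm_mul, e]
      refine (norm_sub_le _ _).trans (add_le_add ((norm_add_le _ _).trans (add_le_add ?_ ?_)) ?_)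
      · rw [norm_mul]; simpa using b4
      · rw [norm_mul, norm_mul]
        simp only [Complex.norm_ofNat, Complex.norm_real, Real.norm_eq_abs]
        gcongr
      · rw [RCLike.norm_conj, norm_mul]; gcongr
    have e3 : ‖bform T (S1 v) y‖ ≤ (2 * (Q * ‖v‖ * r) + 2 * |s| * (A * ‖v‖ * ‖(y : H)‖) +
        ‖μ‖ * (‖(y : H)‖ * (A * ‖v‖))) / ‖μ‖ := by
      rw [le_div_iff₀ hμ']; linarith
    refine e3.trans ?_
    rw [div_le_iff₀ hμ']
    have e4 : C * ‖v‖ * (r + ‖(y : H)‖) * ‖μ‖ =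
      (A * ‖μ‖ + (2 * Q + 2 * |s| * A + ‖μ‖ * A)) * ‖v‖ * (r + ‖(y : H)‖) := by
      rw [hC]; field_simp
    rw [e4]
    have n1 : 0 ≤ A * ‖μ‖ * ‖v‖ * (r + ‖(y : H)‖) := by positivity
    have n2 : 0 ≤ 2 * Q * ‖v‖ * ‖(y : H)‖ := by positivity
    have n3 : 0 ≤ 2 * |s| * A * ‖v‖ * r := by positivity
    have n4 : 0 ≤ ‖μ‖ * A * ‖v‖ * r := by positivity
    nlinarith

lemma starProjection_weakNull (V : Submodule ℂ H) [FiniteDimensional ℂ V]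
    (x : ℕ → H) (hx : ∀ n, ‖x n‖ = 1) (hw : WeakNull x) :
    Tendsto (fun n => ‖V.starProjection (x n)‖) atTop (nhds 0) := by
  have hfin : FiniteDimensional ℂ (LinearMap.range (V.starProjection : H →ₗ[ℂ] H)) := by
    have : LinearMap.range (V.starProjection : H →ₗ[ℂ] H) ≤ V := by
      rintro _ ⟨y, rfl⟩
      exact V.starProjection_apply_mem y
    exact Submodule.finiteDimensional_of_le this
  exact tendsto_zero_iff_norm_tendsto_zero.mp
    (compact_weakNull _ (finiteRank_compact _ hfin) x hx hw)

lemma ess_subset_We1 (T : H →ₗ.[ℂ] H) (hdense : Dense (T.domain : Set H))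
    (h : Dense ((T.domain ⊓ T.adjoint.domain : Submodule ℂ H) : Set H) ∨
      numRange T ≠ Set.univ) : essNumRange T ⊆ We1 T := by
  obtain ⟨μ, c, hp, hkey⟩ := key T hdense h
  rintro z ⟨x, hx, hw, hlim⟩
  change Tendsto (fun n => bform T (x n) (x n)) atTop (nhds z) at hlim
  simp only [We1, Set.mem_iInter]
  intro V hV
  obtain ⟨g, hg, C, hC, hb⟩ := hkey V
  have hd := starProjection_weakNull V _ hx hw
  set d : ℕ → ℝ := fun n => ‖V.starProjection (x n : H)‖ with hdd
  have hg0 : Tendsto (fun n => (g (x n) : H)) atTop (nhds 0) := by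
    apply squeeze_zero_norm (fun n => (hb (x n)).1)
    simpa using hd.const_mul C
  have hTg0 : Tendsto (fun n => T (g (x n))) atTop (nhds 0) := by
    apply squeeze_zero_norm (fun n => (hb (x n)).2.1)
    simpa using hd.const_mul C
  have t1 : Tendsto (fun n => bform T (g (x n)) (x n)) atTop (nhds 0) := by
    apply squeeze_zero_norm (fun n => (hb (x n)).2.2 (x n))
    have hpl : Tendsto (fun n => pf T μ c (x n)) atTop (nhds ((μ * z).re + c)) := by
      have h1 := (Complex.continuous_re.tendsto _).comp (hlim.const_mul μ)
      have h2 := h1.add_const c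
      refine h2.congr fun n => ?_
      simp [pf, hx n]
    have h3 := (hd.const_mul C).mul (hpl.sqrt.add_const 1)
    simp only [mul_zero, zero_mul] at h3
    refine h3.congr fun n => ?_
    rw [hx n]
  have t2 : Tendsto (fun n => bform T (x n) (g (x n))) atTop (nhds 0) := by
    apply squeeze_zero_norm (fun n => ?_) (tendsto_zero_iff_norm_tendsto_zero.mp hTg0)
    exact (norm_inner_le_norm _ _).trans (by simp [hx n])
  have t3 : Tendsto (fun n => bform T (g (x n)) (g (x n))) atTop (nhds 0) := by
    have := Filter.Tendsto.inner (𝕜 := ℂ) hg0 hTg0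
    simpa [bform] using this
  have t4 : Tendsto (fun n => bform T (x n - g (x n)) (x n - g (x n))) atTop (nhds z) := by
    have := ((hlim.sub t1).sub t2).add t3
    simp only [sub_zero, add_zero] at this
    refine this.congr fun n => ?_
    rw [bform_sub_left, bform_sub_right, bform_sub_right]
    ring
  have t5 : Tendsto (fun n => ‖((x n - g (x n) : T.domain) : H)‖) atTop (nhds 1) := by
    rw [tendsto_iff_norm_sub_tendsto_zero]
    refine squeeze_zero (fun _ => norm_nonneg _) (fun n => ?_)
      (tendsto_zero_iff_norm_tendsto_zero.mp hg0)
    have := abs_norm_sub_norm_le ((x n - g (x n) : T.domain) : H) (x n : H)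
    rw [hx n] at this
    simpa using this
  have t6 : Tendsto (fun n => bform T (x n - g (x n)) (x n - g (x n)) /
      (‖((x n - g (x n) : T.domain) : H)‖ : ℂ) ^ 2) atTop (nhds z) := by
    have h1 : Tendsto (fun n => (‖((x n - g (x n) : T.domain) : H)‖ : ℂ)) atTop (nhds 1) := by
      have := (Complex.continuous_ofReal.tendsto 1).comp t5
      rw [Complex.ofReal_one] at this
      exact this
    have h2 := t4.div (h1.pow 2) (by simp)
    rw [one_pow, div_one] at h2
    exact h2
  refine mem_closure_of_tendsto t6 ?_
  filter_upwards [t5.eventually_ne one_ne_zero] with n hn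
  have hn' : ((x n - g (x n) : T.domain) : H) ≠ 0 := norm_ne_zero_iff.mp hn
  have hmem : ((x n - g (x n) : T.domain) : H) ∈ Vᗮ := hg (x n)
  exact numRange_of_ne (T.domRestrict Vᗮ)
    ⟨((x n - g (x n) : T.domain) : H), hmem, (x n - g (x n)).2⟩ hn'

lemma numeric (s ε η C N X Y d r : ℝ) (hε : 0 < ε) (hη : 0 < η) (hC : 0 ≤ C) (hN : 0 ≤ N)
    (hX : 0 ≤ X) (hd : 0 ≤ d) (hY : 0 ≤ Y) (h1 : |Y - X| ≤ C * d) :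
    (s - η) * X ^ 2 - (|s| * C ^ 2 + (N * C) ^ 2 / (4 * ε) + 3 * N * C ^ 2 +
      (2 * |s| * C + 2 * N * C) ^ 2 / (4 * η)) * d ^ 2 ≤
    s * Y ^ 2 + ε * r ^ 2 - N * (C * d * (r + Y) + Y * (C * d) + C * d * (C * d)) := by
  have hCd : 0 ≤ C * d := by positivity
  have a1 : s * X ^ 2 - s * Y ^ 2 ≤ |s| * (C * d * (2 * X + C * d)) := by
    have h2 : |Y ^ 2 - X ^ 2| ≤ C * d * (2 * X + C * d) := by
      have : Y ^ 2 - X ^ 2 = (Y - X) * (Y + X) := by ring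
      rw [this, abs_mul, abs_of_nonneg (by positivity : 0 ≤ Y + X)]
      have : Y + X ≤ 2 * X + C * d := by linarith [(abs_le.mp h1).2]
      gcongr
    calc s * X ^ 2 - s * Y ^ 2 = - (s * (Y ^ 2 - X ^ 2)) := by ring
      _ ≤ |s * (Y ^ 2 - X ^ 2)| := neg_le_abs _
      _ = |s| * |Y ^ 2 - X ^ 2| := abs_mul _ _
      _ ≤ _ := by gcongr
  have a2 : N * C * d * r ≤ ε * r ^ 2 + (N * C) ^ 2 / (4 * ε) * d ^ 2 := by
    have e : ε * r ^ 2 + (N * C) ^ 2 / (4 * ε) * d ^ 2 - N * C * d * r =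
      (2 * ε * r - N * C * d) ^ 2 / (4 * ε) := by field_simp; ring
    have : 0 ≤ (2 * ε * r - N * C * d) ^ 2 / (4 * ε) := by positivity
    linarith
  have a3 : (2 * |s| * C + 2 * N * C) * d * X ≤
      η * X ^ 2 + (2 * |s| * C + 2 * N * C) ^ 2 / (4 * η) * d ^ 2 := by
    generalize 2 * |s| * C + 2 * N * C = q
    have e : η * X ^ 2 + q ^ 2 / (4 * η) * d ^ 2 - q * d * X =
      (2 * η * X - q * d) ^ 2 / (4 * η) := by field_simp; ring
    have : 0 ≤ (2 * η * X - q * d) ^ 2 / (4 * η) := by positivity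
    linarith
  have a4 : N * (C * d) * Y ≤ N * (C * d) * (X + C * d) := by
    have : Y ≤ X + C * d := by linarith [(abs_le.mp h1).2]
    gcongr
  linarith

lemma We2_subset_We1 (T : H →ₗ.[ℂ] H) (hdense : Dense (T.domain : Set H))
    (h : Dense ((T.domain ⊓ T.adjoint.domain : Submodule ℂ H) : Set H) ∨
      numRange T ≠ Set.univ) : We2 T ⊆ We1 T := by
  obtain ⟨μ, c, hp, hkey⟩ := key T hdense h
  intro z hz
  simp only [We1, Set.mem_iInter]
  intro V hV
  by_contra hzV
  obtain ⟨ν0, hν0, s0, hs0, hW⟩ := sep_plane _ (numRange_convex _) z hzV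
  -- tilt the half-plane slightly
  obtain ⟨ε, hε, hν, hs⟩ : ∃ ε : ℝ, 0 < ε ∧ ν0 + ε * μ ≠ 0 ∧
      ((ν0 + ε * μ) * z).re < s0 - ε * c := by
    have c1 : Continuous fun ε : ℝ => ν0 + ε * μ := by fun_prop
    have c2 : Continuous fun ε : ℝ => ((ν0 + ε * μ) * z).re - (s0 - ε * c) :=
      (Complex.continuous_re.comp (c1.mul continuous_const)).sub (by fun_prop)
    have e1 : ∀ᶠ ε : ℝ in nhds (0 : ℝ), ν0 + ε * μ ≠ 0 :=
      (c1.tendsto 0).eventually_ne (by simpa using hν0)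
    have e2 : ∀ᶠ ε : ℝ in nhds (0 : ℝ), ((ν0 + ε * μ) * z).re - (s0 - ε * c) < 0 :=
      (c2.tendsto 0).eventually_lt_const (by simp only [Complex.ofReal_zero, zero_mul, add_zero, sub_zero]; linarith)
    have e3 : ∀ᶠ ε : ℝ in 𝓝[>] (0 : ℝ), 0 < ε ∧ ν0 + ε * μ ≠ 0 ∧
        ((ν0 + ε * μ) * z).re - (s0 - ε * c) < 0 := by
      filter_upwards [self_mem_nhdsWithin, nhdsWithin_le_nhds e1, nhdsWithin_le_nhds e2]
        with ε h1 h2 h3 using ⟨h1, h2, h3⟩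
    obtain ⟨ε, h1, h2, h3⟩ := e3.exists
    exact ⟨ε, h1, h2, by linarith⟩
  set ν : ℂ := ν0 + ε * μ with hνdef
  set s : ℝ := s0 - ε * c with hsdef
  have hlow : ∀ y : T.domain, (y : H) ∈ Vᗮ →
      s * ‖(y : H)‖ ^ 2 + ε * pf T μ c y ≤ (ν * bform T y y).re := by
    intro y hyV
    have h0 : s0 * ‖(y : H)‖ ^ 2 ≤ (ν0 * bform T y y).re := by
      by_cases hy : (y : H) = 0
      · have : y = 0 := by ext; simpa using hy
        subst this
        simp [bform]
      have h1 := hW _ (numRange_of_ne (T.domRestrict Vᗮ) ⟨(y : H), hyV, y.2⟩ hy)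
      change s0 ≤ (ν0 * (bform T y y / (‖(y : H)‖ : ℂ) ^ 2)).re at h1
      have h0 : 0 < ‖(y : H)‖ := norm_pos_iff.mpr hy
      rwa [← mul_div_assoc, ← Complex.ofReal_pow, Complex.div_ofReal_re,
        le_div_iff₀ (by positivity)] at h1
    have e : (ν * bform T y y).re = (ν0 * bform T y y).re + ε * (μ * bform T y y).re := by
      rw [hνdef, add_mul, Complex.add_re, mul_assoc, Complex.re_ofReal_mul]
    rw [e, pf, hsdef]
    linarith
  obtain ⟨g, hg, C, hC, hb⟩ := hkey V
  obtain ⟨η, hη, hη'⟩ : ∃ η : ℝ, 0 < η ∧ (ν * z).re < s - η :=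
    ⟨(s - (ν * z).re) / 2, by linarith, by linarith⟩
  set M : ℝ := |s| * C ^ 2 + (‖ν‖ * C) ^ 2 / (4 * ε) + 3 * ‖ν‖ * C ^ 2 +
      (2 * |s| * C + 2 * ‖ν‖ * C) ^ 2 / (4 * η) with hM
  have hlow2 : ∀ x : T.domain,
      (s - η) * ‖(x : H)‖ ^ 2 - M * ‖V.starProjection (x : H)‖ ^ 2 ≤ (ν * bform T x x).re := by
    intro x
    obtain ⟨b1, b2, b3⟩ := hb (x : H)
    set f := g (x : H) with hf
    set y : T.domain := x - f with hy
    set d := ‖V.starProjection (x : H)‖ with hd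
    have hyV : (y : H) ∈ Vᗮ := hg x
    have hxy : x = y + f := by simp [hy]
    have hl := hlow y hyV
    have hYX : |‖(y : H)‖ - ‖(x : H)‖| ≤ C * d := by
      refine (abs_norm_sub_norm_le _ _).trans ?_
      simpa [hy] using b1
    have hn := numeric s ε η C ‖ν‖ ‖(x : H)‖ ‖(y : H)‖ d (√(pf T μ c y)) hε hη hC (norm_nonneg _)
      (norm_nonneg _) (norm_nonneg _) (norm_nonneg _) hYX
    rw [Real.sq_sqrt (hp y)] at hn
    have e : (ν * bform T x x).re = (ν * bform T y y).re +
        (ν * (bform T f y + bform T y f + bform T f f)).re := by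
      rw [← Complex.add_re, ← mul_add]
      congr 2
      rw [hxy, bform_add_left, bform_add_right, bform_add_right]
      ring
    have hcross : ‖ν * (bform T f y + bform T y f + bform T f f)‖ ≤
        ‖ν‖ * (C * d * (√(pf T μ c y) + ‖(y : H)‖) + ‖(y : H)‖ * (C * d) + C * d * (C * d)) := by
      rw [norm_mul]
      gcongr
      refine (norm_add_le _ _).trans (add_le_add ((norm_add_le _ _).trans (add_le_add (b3 y) ?_)) ?_)
      · refine (norm_inner_le_norm _ _).trans ?_
        gcongr
      · refine (norm_inner_le_norm _ _).trans ?_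
        gcongr
    have hre := (abs_le.mp (Complex.abs_re_le_norm (ν * (bform T f y + bform T y f + bform T f f)))).1
    rw [e]
    linarith
  -- the finite rank perturbation
  let K : H →L[ℂ] H := (((M : ℂ) / ν)) • V.starProjection
  have hKfin : FiniteDimensional ℂ (LinearMap.range (K : H →ₗ[ℂ] H)) := by
    have : LinearMap.range (K : H →ₗ[ℂ] H) ≤ V := by
      rintro _ ⟨y, rfl⟩
      exact V.smul_mem _ (V.starProjection_apply_mem y)
    exact Submodule.finiteDimensional_of_le this
  simp only [We2, Set.mem_iInter] at hz
  have hzK := hz K hKfin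
  have hsub : closure (numRange (pmapAddCLM T K)) ⊆ {w : ℂ | s - η ≤ (ν * w).re} := by
    apply closure_minimal
    · rintro _ ⟨x, hx, rfl⟩
      let x' : T.domain := x
      have hx' : ‖(x' : H)‖ = 1 := hx
      have e1 : inner ℂ (x : H) (pmapAddCLM T K x) =
          bform T x' x' + inner ℂ (x' : H) (K (x' : H)) := by
        rw [bform, ← inner_add_right]; rfl
      have e2 : inner ℂ (x' : H) (V.starProjection (x' : H)) =
          ((‖V.starProjection (x' : H)‖ ^ 2 : ℝ) : ℂ) := by
        have h1 : V.starProjection (V.starProjection (x' : H)) = V.starProjection (x' : H) :=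
          Submodule.starProjection_eq_self_iff.mpr (V.starProjection_apply_mem _)
        rw [← h1, ← Submodule.inner_starProjection_left_eq_right, h1, inner_self_eq_norm_sq_to_K]
        simp
      have e3 : ν * inner ℂ (x' : H) (K (x' : H)) =
          ((M * ‖V.starProjection (x' : H)‖ ^ 2 : ℝ) : ℂ) := by
        simp only [K, smul_apply, inner_smul_right, e2]
        push_cast
        field_simp
      have hl := hlow2 x'
      rw [hx'] at hl
      change s - η ≤ (ν * inner ℂ (x : H) (pmapAddCLM T K x)).re
      rw [e1, mul_add, e3, Complex.add_re, Complex.ofReal_re]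
      linarith
    · exact isClosed_le continuous_const
        (Complex.continuous_re.comp (continuous_const.mul continuous_id))
  have : s - η ≤ (ν * z).re := hsub hzK
  linarith

/-- Theorem 3.1, (3.3): if `T` is densely defined and `dom T ∩ dom T*` is dense in `H`
or `W(T) ≠ ℂ`, then all characterizations of the essential numerical range coincide. -/
theorem We_characterizations_eq
    [TopologicalSpace.SeparableSpace H] (hinf : ¬FiniteDimensional ℂ H)
    (T : H →ₗ.[ℂ] H) (hdense : Dense (T.domain : Set H))
    (h : Dense ((T.domain ⊓ T.adjoint.domain : Submodule ℂ H) : Set H) ∨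
      numRange T ≠ Set.univ) :
    We1 T = essNumRange T ∧ We2 T = essNumRange T ∧ We3 T = essNumRange T ∧
      We4 T = essNumRange T := by

  have h14 := We1_subset_We4 T
  have h4e := We4_subset T
  have he1 := ess_subset_We1 T hdense h
  have he3 := ess_subset_We3 T
  have h32 := We3_subset_We2 T
  have h21 := We2_subset_We1 T hdense h
  have h1e := h14.trans h4e
  exact ⟨h1e.antisymm he1, (h21.trans h1e).antisymm (he3.trans h32),
    ((h32.trans h21).trans h1e).antisymm he3, h4e.antisymm (he1.trans h14)⟩
end
end

section
/- Let T be a densely defined linear operator in H such that dom(T) ∩ dom(T*) is a core of T*, i.e. the closure of the graph of the restriction of T* to dom(T) ∩ dom(T*) equals the graph of T*. Then conv(σ_e(T) ∪ σ_e(T*)^*) ⊆ W_e(T), where Ω^* := {conj(z) : z ∈ Ω} for Ω ⊆ ℂ. -/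
open Filter Topology

noncomputable section

variable {H : Type*} [NormedAddCommGroup H] [InnerProductSpace ℂ H] [CompleteSpace H]

lemma quad_aux (l m A B p : ℂ) (t : ℝ) (ht0 : 0 ≤ t) (ht1 : t ≤ 1) :
    ∃ a b : ℂ, (a ≠ 0 ∨ b ≠ 0) ∧
      (starRingEnd ℂ a * a) * l + (starRingEnd ℂ b * b) * m + starRingEnd ℂ a * b * A
        + starRingEnd ℂ b * a * B
      = ((1 - t : ℝ) * l + (t : ℝ) * m) * (starRingEnd ℂ a * a + starRingEnd ℂ b * b
        + starRingEnd ℂ a * b * p + starRingEnd ℂ b * a * starRingEnd ℂ p) := by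
  by_cases hlm : m = l
  · subst hlm
    refine ⟨1, 0, Or.inl one_ne_zero, ?_⟩
    simp
    ring
  have hd : m - l ≠ 0 := sub_ne_zero.2 hlm
  obtain ⟨A', hA'⟩ : ∃ A', A = l * p + (m - l) * A' := ⟨(A - l * p) / (m - l), by field_simp; ring⟩
  obtain ⟨B', hB'⟩ : ∃ B', B = l * starRingEnd ℂ p + (m - l) * B' :=
    ⟨(B - l * starRingEnd ℂ p) / (m - l), by field_simp; ring⟩
  obtain ⟨u, hu, c, hc⟩ : ∃ u : ℂ, starRingEnd ℂ u * u = 1 ∧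
      ∃ c : ℝ, starRingEnd ℂ u * A' + u * B' = c := by
    have key : ∀ u : ℂ, (u * (B' - starRingEnd ℂ A')).im = 0 →
        ∃ c : ℝ, starRingEnd ℂ u * A' + u * B' = c := by
      intro u h
      refine ⟨(starRingEnd ℂ u * A' + u * B').re, ?_⟩
      apply Complex.ext
      · simp
      · simp at h ⊢
        linarith
    by_cases h0 : B' - starRingEnd ℂ A' = 0
    · exact ⟨1, by simp, key 1 (by rw [h0]; simp)⟩
    · set D := B' - starRingEnd ℂ A' with hD
      have hn : (‖D‖ : ℂ) ≠ 0 := by simpa using h0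
      have hDD : starRingEnd ℂ D * D = (‖D‖ : ℂ) ^ 2 := Complex.conj_mul' D
      refine ⟨starRingEnd ℂ D / ‖D‖, ?_, key _ ?_⟩
      · simp only [map_div₀, Complex.conj_conj, Complex.conj_ofReal]
        field_simp
        linear_combination hDD
      · have : starRingEnd ℂ D / ‖D‖ * D = (‖D‖ : ℂ) := by
          field_simp
          linear_combination hDD
        rw [this, Complex.ofReal_im]
  obtain ⟨q, hq⟩ : ∃ q : ℝ, starRingEnd ℂ u * p + u * starRingEnd ℂ p = q := by
    refine ⟨(starRingEnd ℂ u * p + u * starRingEnd ℂ p).re, ?_⟩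
    apply Complex.ext
    · simp
    · simp
      ring
  have hcont : ContinuousOn (fun s : ℝ => s ^ 2 + (1 - s) * s * c
      - t * ((1 - s) ^ 2 + s ^ 2 + (1 - s) * s * q)) (Set.Icc 0 1) := by fun_prop
  have := intermediate_value_Icc zero_le_one hcont
  obtain ⟨s, hs, hs0⟩ := this (show (0 : ℝ) ∈ _ from ⟨by norm_num; exact ht0, by norm_num; exact ht1⟩)
  have hu0 : u ≠ 0 := by rintro rfl; simp at hu
  refine ⟨(1 - s : ℝ) * u, (s : ℝ), ?_, ?_⟩
  · by_cases h : s = 0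
    · left; subst h; simpa using hu0
    · right; simpa using h
  · have hs1 : (s : ℂ) ^ 2 + (1 - s) * s * c - t * ((1 - s) ^ 2 + s ^ 2 + (1 - s) * s * q) = 0 := by
      exact_mod_cast hs0
    simp only [map_mul, Complex.conj_ofReal]
    push_cast
    rw [hA', hB']
    linear_combination (m - l) * hs1 + ((1 - s) ^ 2 * l - (1 - s) ^ 2 * ((1 - t) * l + t * m)) * hu
      + (m - l) * (1 - s) * s * hc + (1 - s) * s * (l - ((1 - t) * l + t * m)) * hq

lemma comb_bound (x y : H) (hx : ‖x‖ = 1) (hy : ‖y‖ = 1) (hxy : ‖(inner ℂ x y : ℂ)‖ ≤ 1 / 2)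
    (a b : ℂ) : ‖a‖ ^ 2 + ‖b‖ ^ 2 ≤ 2 * ‖a • x + b • y‖ ^ 2 := by
  have h := norm_add_sq (𝕜 := ℂ) (a • x) (b • y)
  have h2 : ‖(inner ℂ (a • x) (b • y) : ℂ)‖ ≤ ‖a‖ * ‖b‖ * (1 / 2) := by
    rw [inner_smul_left, inner_smul_right, norm_mul, norm_mul, RCLike.norm_conj, ← mul_assoc]
    gcongr
  have h3 := (abs_le.1 (RCLike.abs_re_le_norm (inner ℂ (a • x) (b • y) : ℂ))).1
  rw [norm_smul, norm_smul, hx, hy] at h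
  nlinarith [sq_nonneg (‖a‖ - ‖b‖)]

lemma hausdorff_aux (T : H →ₗ.[ℂ] H) (x y : T.domain) (hx : ‖(x : H)‖ = 1) (hy : ‖(y : H)‖ = 1)
    (hxy : ‖(inner ℂ (x : H) (y : H) : ℂ)‖ ≤ 1 / 2) (t : ℝ) (ht0 : 0 ≤ t) (ht1 : t ≤ 1) :
    ∃ a b : ℂ, ‖a‖ ≤ 2 ∧ ‖b‖ ≤ 2 ∧ ‖((a • x + b • y : T.domain) : H)‖ = 1 ∧
      (inner ℂ ((a • x + b • y : T.domain) : H) (T (a • x + b • y)) : ℂ)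
        = (1 - t : ℝ) * inner ℂ (x : H) (T x) + (t : ℝ) * inner ℂ (y : H) (T y) := by
  obtain ⟨a, b, hab, h⟩ := quad_aux (inner ℂ (x : H) (T x)) (inner ℂ (y : H) (T y))
    (inner ℂ (x : H) (T y)) (inner ℂ (y : H) (T x)) (inner ℂ (x : H) (y : H)) t ht0 ht1
  set N := ‖a • (x : H) + b • (y : H)‖ with hN
  have hb := comb_bound (x : H) (y : H) hx hy hxy a b
  have hNpos : 0 < N := by
    have h0 : 0 < ‖a‖ ^ 2 + ‖b‖ ^ 2 := by
      rcases hab with h | h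
      · have := norm_pos_iff.2 h; positivity
      · have := norm_pos_iff.2 h; positivity
    have : 0 < N ^ 2 := by linarith
    exact (norm_nonneg _).lt_of_ne (fun h => by rw [hN, ← h] at this; simp at this)
  have hNC : (N : ℂ) ≠ 0 := by exact_mod_cast hNpos.ne'
  have hN2 : starRingEnd ℂ a * a + starRingEnd ℂ b * b + starRingEnd ℂ a * b * inner ℂ (x : H) (y : H)
        + starRingEnd ℂ b * a * starRingEnd ℂ (inner ℂ (x : H) (y : H)) = (N : ℂ) ^ 2 := by
    have := inner_self_eq_norm_sq_to_K (𝕜 := ℂ) (a • (x : H) + b • (y : H))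
    have hxx := inner_self_eq_norm_sq_to_K (𝕜 := ℂ) (x : H)
    have hyy := inner_self_eq_norm_sq_to_K (𝕜 := ℂ) (y : H)
    rw [hx] at hxx
    rw [hy] at hyy
    rw [← hN] at this
    simp only [inner_add_left, inner_add_right, inner_smul_left, inner_smul_right, hxx, hyy] at this
    rw [inner_conj_symm]
    simp at this
    rw [← this]
    ring
  rw [hN2] at h
  have hsm : ((a / N) • x + (b / N) • y : T.domain) = (N : ℂ)⁻¹ • (a • x + b • y) := by
    rw [smul_add, smul_smul, smul_smul]; congr 2 <;> ring
  have hle : ‖a‖ ≤ 2 * N ∧ ‖b‖ ≤ 2 * N := by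
    constructor <;> refine (pow_le_pow_iff_left₀ (norm_nonneg _) (by positivity) two_ne_zero).1 ?_ <;> nlinarith [sq_nonneg ‖a‖, sq_nonneg ‖b‖]
  refine ⟨a / N, b / N, ?_, ?_, ?_, ?_⟩
  · rw [norm_div, Complex.norm_real, Real.norm_of_nonneg hNpos.le, div_le_iff₀ hNpos]; exact hle.1
  · rw [norm_div, Complex.norm_real, Real.norm_of_nonneg hNpos.le, div_le_iff₀ hNpos]; exact hle.2
  · rw [hsm, Submodule.coe_smul, norm_smul, norm_inv, Complex.norm_real,
      Real.norm_of_nonneg hNpos.le]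
    simp only [Submodule.coe_add, Submodule.coe_smul]
    rw [← hN]
    exact inv_mul_cancel₀ hNpos.ne'
  · rw [hsm, T.map_smul, T.map_add, T.map_smul, T.map_smul]
    simp only [Submodule.coe_add, Submodule.coe_smul, inner_add_left, inner_add_right,
      inner_smul_left, inner_smul_right, map_inv₀, Complex.conj_ofReal]
    field_simp
    linear_combination h

lemma convex_essNumRange (T : H →ₗ.[ℂ] H) : Convex ℝ (essNumRange T) := by
  rintro l ⟨x, hx1, hx0, hxl⟩ m ⟨y, hy1, hy0, hym⟩ s t hs ht hst
  have hm : ∀ n, ∃ k, n ≤ k ∧ ‖(inner ℂ (x n : H) (y k : H) : ℂ)‖ ≤ 1 / 2 := by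
    intro n
    have h := (hy0 (x n : H)).norm
    rw [norm_zero] at h
    obtain ⟨k, h1, h2⟩ := ((h.eventually_le_const (by norm_num : (0 : ℝ) < 1 / 2)).and
      (eventually_ge_atTop n)).exists
    exact ⟨k, h2, by rw [norm_inner_symm]; exact h1⟩
  choose k hk hk2 using hm
  have hkt : Tendsto k atTop atTop := tendsto_atTop_mono hk tendsto_id
  choose a b ha hb h1 h2 using fun n =>
    hausdorff_aux T (x n) (y (k n)) (hx1 n) (hy1 _) (hk2 n) t ht (by linarith)
  refine ⟨fun n => a n • x n + b n • y (k n), h1, ?_, ?_⟩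
  · intro v
    have e1 := (hx0 v).norm
    have e2 := ((hy0 v).comp hkt).norm
    have e3 := (e1.const_mul 2).add (e2.const_mul 2)
    simp only [norm_zero, mul_zero, add_zero] at e3
    refine squeeze_zero_norm (fun n => ?_) e3
    simp only [Submodule.coe_add, Submodule.coe_smul, inner_add_left, inner_smul_left]
    refine (norm_add_le _ _).trans ?_
    rw [norm_mul, norm_mul, RCLike.norm_conj, RCLike.norm_conj]
    simp only [Function.comp]
    gcongr
    · exact ha n
    · exact hb n
  · simp only [h2]
    have hs' : s = 1 - t := by linarith
    subst hs'
    rw [Complex.real_smul, Complex.real_smul]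
    exact (hxl.const_mul _).add ((hym.comp hkt).const_mul _)

lemma mem_of_inner (x v : H) (z : ℂ) (hx : ‖x‖ = 1) :
    (inner ℂ x v : ℂ) - z = inner ℂ x (v - z • x) := by
  rw [inner_sub_right, inner_smul_right, inner_self_eq_norm_sq_to_K, hx]
  simp

lemma essSpec_subset (T : H →ₗ.[ℂ] H) : essSpec T ⊆ essNumRange T := by
  rintro z ⟨x, hx1, hx0, hxz⟩
  refine ⟨x, hx1, hx0, ?_⟩
  rw [← tendsto_sub_nhds_zero_iff]
  refine squeeze_zero_norm (fun n => ?_) hxz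
  rw [mem_of_inner _ _ _ (hx1 n)]
  refine (norm_inner_le_norm _ _).trans ?_
  rw [hx1 n, one_mul]

lemma normalise (T : H →ₗ.[ℂ] H) (w : ℕ → T.domain) (z : ℂ) (hw : ∀ n, (w n : H) ≠ 0)
    (h1 : Tendsto (fun n => ‖(w n : H)‖) atTop (𝓝 1)) (h0 : WeakNull (fun n => (w n : H)))
    (hz : Tendsto (fun n => (inner ℂ (w n : H) (T (w n)) : ℂ)) atTop (𝓝 z)) :
    z ∈ essNumRange T := by
  have hc : Tendsto (fun n => ((‖(w n : H)‖ : ℂ))⁻¹) atTop (𝓝 1) := by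
    have := ((Complex.continuous_ofReal.tendsto 1).comp h1).inv₀ (by simp)
    simpa using this
  refine ⟨fun n => ((‖(w n : H)‖ : ℂ))⁻¹ • w n, fun n => ?_, fun v => ?_, ?_⟩
  · rw [Submodule.coe_smul, norm_smul, norm_inv, Complex.norm_real, norm_norm]
    exact inv_mul_cancel₀ (norm_ne_zero_iff.2 (hw n))
  · have := (h0 v).mul hc
    simpa [inner_smul_left] using this
  · have := hc.mul (hz.mul hc)
    simpa [inner_smul_left, inner_smul_right, T.map_smul] using this

lemma conj_mem_of_core (T : H →ₗ.[ℂ] H) (hdense : Dense (T.domain : Set H))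
    (hcore : (T.adjoint.domRestrict T.domain).graph.topologicalClosure = T.adjoint.graph)
    {z : ℂ} (hz : z ∈ essSpec T.adjoint) : starRingEnd ℂ z ∈ essNumRange T := by
  obtain ⟨x, hx1, hx0, hxz⟩ := hz
  have happ : ∀ n : ℕ, ∃ (w : T.domain) (w' : T.adjoint.domain), (w : H) = w' ∧
      ‖(w : H) - x n‖ ≤ 1 / ((n : ℝ) + 2) ∧
      ‖T.adjoint w' - T.adjoint (x n)‖ ≤ 1 / ((n : ℝ) + 2) := by
    intro n
    have hmem : ((x n : H), T.adjoint (x n)) ∈ closure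
        ((T.adjoint.domRestrict T.domain).graph : Set (H × H)) := by
      rw [← Submodule.topologicalClosure_coe, hcore]
      exact T.adjoint.mem_graph (x n)
    obtain ⟨g, hg, hd⟩ := Metric.mem_closure_iff.1 hmem (1 / ((n : ℝ) + 2)) (by positivity)
    obtain ⟨v, hv1, hv2⟩ := (LinearPMap.mem_graph_iff _).1 hg
    have hv : (v : H) ∈ T.domain ∧ (v : H) ∈ T.adjoint.domain := v.2
    have hval : T.adjoint.domRestrict T.domain v = T.adjoint ⟨v, hv.2⟩ :=
      LinearPMap.domRestrict_apply rfl
    rw [dist_comm, Prod.dist_eq, max_lt_iff, dist_eq_norm, dist_eq_norm, ← hv1, ← hv2, hval] at hd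
    exact ⟨⟨v, hv.1⟩, ⟨v, hv.2⟩, rfl, hd.1.le, hd.2.le⟩
  choose w w' hww hw1 hw2 using happ
  have he : Tendsto (fun n : ℕ => 1 / ((n : ℝ) + 2)) atTop (𝓝 0) :=
    tendsto_const_nhds.div_atTop (tendsto_atTop_add_const_right _ _ tendsto_natCast_atTop_atTop)
  have hnd : ∀ n, |‖(w n : H)‖ - 1| ≤ 1 / ((n : ℝ) + 2) := fun n => by
    have := abs_norm_sub_norm_le (w n : H) (x n : H)
    rw [hx1] at this
    exact this.trans (hw1 n)
  have hn1 : Tendsto (fun n => ‖(w n : H)‖) atTop (𝓝 1) := by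
    rw [← tendsto_sub_nhds_zero_iff]
    exact squeeze_zero_norm hnd he
  apply normalise T w _ _ hn1
  · intro v
    have h1 : Tendsto (fun n => (inner ℂ ((w n : H) - x n) v : ℂ)) atTop (𝓝 0) := by
      refine squeeze_zero_norm (fun n => (norm_inner_le_norm _ _).trans
        (mul_le_mul_of_nonneg_right (hw1 n) (norm_nonneg v))) ?_
      simpa using he.mul_const ‖v‖
    have := h1.add (hx0 v)
    simpa [inner_sub_left] using this
  · have hr : Tendsto (fun n => ‖T.adjoint (w' n) - z • (w n : H)‖) atTop (𝓝 0) := by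
      have hb := (he.add hxz).add (he.const_mul ‖z‖)
      simp only [mul_zero, add_zero] at hb
      refine squeeze_zero (fun n => norm_nonneg _) (fun n => ?_) hb
      have e : T.adjoint (w' n) - z • (w n : H) = (T.adjoint (w' n) - T.adjoint (x n))
          + (T.adjoint (x n) - z • (x n : H)) + (- z) • ((w n : H) - x n) := by
        module
      rw [e]
      refine (norm_add₃_le).trans ?_
      rw [norm_smul, norm_neg]
      gcongr
      · exact hw2 n
      · exact hw1 n
    have h1 : Tendsto (fun n => (inner ℂ (T.adjoint (w' n) - z • (w n : H)) (w n : H) : ℂ)) atTop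
        (𝓝 0) := by
      refine squeeze_zero_norm (fun n => norm_inner_le_norm _ _) ?_
      simpa using hr.mul hn1
    have h2 : Tendsto (fun n => starRingEnd ℂ z * (‖(w n : H)‖ : ℂ) ^ 2) atTop
        (𝓝 (starRingEnd ℂ z)) := by
      have := (((Complex.continuous_ofReal.tendsto 1).comp hn1).pow 2).const_mul (starRingEnd ℂ z)
      simpa using this
    have h3 := h1.add h2
    rw [zero_add] at h3
    refine h3.congr (fun n => ?_)
    have hadj := LinearPMap.adjoint_isFormalAdjoint hdense (w' n) (w n)
    rw [← hww] at hadj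
    rw [← hadj, inner_sub_left, inner_smul_left, inner_self_eq_norm_sq_to_K]
    simp
  · intro n h
    have := hnd n
    rw [h, norm_zero, zero_sub, abs_neg, abs_one, le_div_iff₀ (by positivity)] at this
    have := (n.cast_nonneg : (0 : ℝ) ≤ n)
    linarith

/-- Remark 3.3 i): if `dom T ∩ dom T*` is a core of `T*`, then
`conv(σ_e(T) ∪ σ_e(T*)^*) ⊆ W_e(T)`. -/
theorem convexHull_essSpec_union_conj_essSpec_adjoint_subset_essNumRange
    [TopologicalSpace.SeparableSpace H] (hinf : ¬FiniteDimensional ℂ H)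
    (T : H →ₗ.[ℂ] H) (hdense : Dense (T.domain : Set H))
    (hcore : (T.adjoint.domRestrict T.domain).graph.topologicalClosure = T.adjoint.graph) :
    convexHull ℝ (essSpec T ∪ (starRingEnd ℂ) '' essSpec T.adjoint) ⊆ essNumRange T := by
  refine convexHull_min (Set.union_subset (essSpec_subset T) ?_) (convex_essNumRange T)
  rintro _ ⟨z, hz, rfl⟩
  exact conj_mem_of_core T hdense hcore hz
end
end

section
/- Let T be a linear operator in H and let K be a compact bounded operator on H. Then W_e(T + K) = W_e(T), W_{e1}(T + K) = W_{e1}(T), and W_{e4}(T + K) = W_{e4}(T), where T + K has domain dom(T). -/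
open Filter Topology

noncomputable section

variable {H : Type*} [NormedAddCommGroup H] [InnerProductSpace ℂ H] [CompleteSpace H]

/-- Finite net for the image of the unit ball under a compact operator. -/
theorem aux_net (K : H →L[ℂ] H) (hK : IsCompactOperator fun x : H => K x) {ε : ℝ} (hε : 0 < ε) :
    ∃ F : Set H, F.Finite ∧ ∀ x : H, ‖x‖ = 1 → ∃ y ∈ F, ‖K x - y‖ < ε := by
  have hK' : IsCompactOperator (K : H →ₗ[ℂ] H) := hK
  obtain ⟨C, hC, hsub⟩ := hK'.image_closedBall_subset_compact 1
  obtain ⟨F, hF, hcov⟩ := Metric.totallyBounded_iff.1 hC.totallyBounded ε hε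
  refine ⟨F, hF, fun x hx => ?_⟩
  have h1 : K x ∈ C := hsub ⟨x, by simp [hx], rfl⟩
  obtain ⟨y, hy, hxy⟩ := Set.mem_iUnion₂.1 (hcov h1)
  exact ⟨y, hy, by simpa [dist_eq_norm] using hxy⟩

theorem aux_bound (K : H →L[ℂ] H) {ε : ℝ} {x y : H} (hx : ‖x‖ = 1) (h : ‖K x - y‖ < ε) :
    ‖(inner ℂ x (K x) : ℂ)‖ < ε + ‖(inner ℂ x y : ℂ)‖ := by
  have h1 : (inner ℂ x (K x) : ℂ) = inner ℂ x (K x - y) + inner ℂ x y := by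
    rw [← inner_add_right]; simp
  have h2 : ‖(inner ℂ x (K x - y) : ℂ)‖ ≤ ‖x‖ * ‖K x - y‖ := norm_inner_le_norm _ _
  rw [hx, one_mul] at h2
  rw [h1]
  have h3 := norm_add_le (inner ℂ x (K x - y) : ℂ) (inner ℂ x y)
  linarith

theorem aux_weakNull (K : H →L[ℂ] H) (hK : IsCompactOperator fun x : H => K x)
    (x : ℕ → H) (hx : ∀ n, ‖x n‖ = 1) (hw : WeakNull x) :
    Tendsto (fun n => (inner ℂ (x n) (K (x n)) : ℂ)) atTop (nhds 0) := by
  rw [Metric.tendsto_nhds]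
  intro ε hε
  obtain ⟨F, hF, hnet⟩ := aux_net K hK (half_pos hε)
  have hev : ∀ᶠ n in atTop, ∀ y ∈ F, ‖(inner ℂ (x n) y : ℂ)‖ < ε / 2 := by
    rw [Filter.eventually_all_finite hF]
    intro y _
    have := (Metric.tendsto_nhds.1 (hw y)) (ε / 2) (half_pos hε)
    simpa using this
  filter_upwards [hev] with n hn
  obtain ⟨y, hy, hxy⟩ := hnet (x n) (hx n)
  have h1 := aux_bound K (hx n) hxy
  have h2 := hn y hy
  rw [dist_zero_right]
  linarith

theorem aux_orthonormal (x : ℕ → H) (hx : Orthonormal ℂ x) : WeakNull x := by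
  intro y
  have h := (hx.inner_products_summable (x := y)).tendsto_atTop_zero
  rw [tendsto_zero_iff_norm_tendsto_zero]
  have h2 := h.sqrt
  simpa using h2

theorem aux_apply (T : H →ₗ.[ℂ] H) (K : H →L[ℂ] H) (x : T.domain) :
    (pmapAddCLM T K) (x : (pmapAddCLM T K).domain) = T x + K (x : H) := rfl

theorem aux_neg (T : H →ₗ.[ℂ] H) (K : H →L[ℂ] H) :
    pmapAddCLM (pmapAddCLM T K) (-K) = T := by
  refine LinearPMap.ext rfl fun x hx hx' => ?_
  change T ⟨x, hx⟩ + K x + (-K) x = T ⟨x, hx⟩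
  simp

theorem aux_ess (T : H →ₗ.[ℂ] H) (K : H →L[ℂ] H) (hK : IsCompactOperator fun x : H => K x) :
    essNumRange T ⊆ essNumRange (pmapAddCLM T K) := by
  rintro z ⟨x, hx, hw, ht⟩
  refine ⟨x, hx, hw, ?_⟩
  have h := ht.add (aux_weakNull K hK _ hx hw)
  rw [add_zero] at h
  refine h.congr fun n => ?_
  rw [← inner_add_right]
  rfl

theorem aux_We4 (T : H →ₗ.[ℂ] H) (K : H →L[ℂ] H) (hK : IsCompactOperator fun x : H => K x) :
    We4 T ⊆ We4 (pmapAddCLM T K) := by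
  rintro z ⟨x, hx, ht⟩
  refine ⟨x, hx, ?_⟩
  have h := ht.add (aux_weakNull K hK _ hx.1 (aux_orthonormal _ hx))
  rw [add_zero] at h
  refine h.congr fun n => ?_
  rw [← inner_add_right]
  rfl

theorem aux_We1 (T : H →ₗ.[ℂ] H) (K : H →L[ℂ] H) (hK : IsCompactOperator fun x : H => K x) :
    We1 T ⊆ We1 (pmapAddCLM T K) := by
  intro z hz
  refine Set.mem_iInter₂.2 fun V hV => Metric.mem_closure_iff.2 fun ε hε => ?_
  obtain ⟨F, hF, hnet⟩ := aux_net K hK (half_pos hε)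
  have hfd : FiniteDimensional ℂ (Submodule.span ℂ F) := FiniteDimensional.span_of_finite ℂ hF
  have hz' := Set.mem_iInter₂.1 hz (V ⊔ Submodule.span ℂ F) inferInstance
  obtain ⟨w, ⟨x, hx, hxw⟩, hw⟩ := Metric.mem_closure_iff.1 hz' (ε / 2) (half_pos hε)
  obtain ⟨x, hxm⟩ := x
  have hxo : x ∈ (V ⊔ Submodule.span ℂ F)ᗮ := hxm.1
  have hxd : x ∈ T.domain := hxm.2
  have hxV : x ∈ Vᗮ := Submodule.orthogonal_le le_sup_left hxo
  have hx1 : ‖x‖ = 1 := hx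
  have hxw' : (inner ℂ x (T ⟨x, hxd⟩) : ℂ) = w := hxw
  refine ⟨inner ℂ x (T ⟨x, hxd⟩ + K x), ⟨⟨x, hxV, hxd⟩, hx1, rfl⟩, ?_⟩
  obtain ⟨y, hy, hxy⟩ := hnet x hx1
  have h1 := aux_bound K hx1 hxy
  have h0 : (inner ℂ x y : ℂ) = 0 :=
    Submodule.inner_left_of_mem_orthogonal
      ((le_sup_right : _ ≤ V ⊔ Submodule.span ℂ F) (Submodule.subset_span hy)) hxo
  rw [h0, norm_zero, add_zero] at h1
  rw [inner_add_right, hxw']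
  have h2 : dist w (w + inner ℂ x (K x)) < ε / 2 := by simpa using h1
  linarith [dist_triangle z w (w + inner ℂ x (K x))]

/-- Proposition 4.1: invariance of `W_e`, `W_{e1}`, `W_{e4}` under compact perturbations. -/
theorem essNumRange_We1_We4_compact_perturbation
    [TopologicalSpace.SeparableSpace H] (hinf : ¬FiniteDimensional ℂ H)
    (T : H →ₗ.[ℂ] H) (K : H →L[ℂ] H) (hK : IsCompactOperator fun x : H => K x) :
    essNumRange (pmapAddCLM T K) = essNumRange T ∧
      We1 (pmapAddCLM T K) = We1 T ∧ We4 (pmapAddCLM T K) = We4 T := by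
  have hK2 : IsCompactOperator fun x : H => (-K) x := hK.neg
  refine ⟨Set.Subset.antisymm ?_ (aux_ess T K hK), Set.Subset.antisymm ?_ (aux_We1 T K hK),
    Set.Subset.antisymm ?_ (aux_We4 T K hK)⟩
  · simpa only [aux_neg] using aux_ess (pmapAddCLM T K) (-K) hK2
  · simpa only [aux_neg] using aux_We1 (pmapAddCLM T K) (-K) hK2
  · simpa only [aux_neg] using aux_We4 (pmapAddCLM T K) (-K) hK2
end
end

section
/- Let T be a selfadjoint operator in H and let S be a symmetric operator in H which is T-compact. Then W_e(T) = W_e(T + S), where T + S has domain dom(T). -/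
open Filter Topology

noncomputable section

variable {H : Type*} [NormedAddCommGroup H] [InnerProductSpace ℂ H] [CompleteSpace H]

/-- A linear operator `S` in `H` is symmetric if `⟨Sx, y⟩ = ⟨x, Sy⟩` for all
`x, y ∈ dom S`. -/
def IsSymmetricP (S : H →ₗ.[ℂ] H) : Prop :=
  ∀ x y : S.domain, (inner ℂ (S x) ((y : H)) : ℂ) = inner ℂ ((x : H)) (S y)

/-- `S` is `T`-compact: `dom S ⊇ dom T` and every sequence `(x_n) ⊆ dom T` with
`(‖x_n‖)` and `(‖T x_n‖)` bounded has a subsequence along which `(S x_n)` converges. -/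
def RelCompactP (S T : H →ₗ.[ℂ] H) : Prop :=
  ∃ h : T.domain ≤ S.domain, ∀ x : ℕ → T.domain,
    (∃ C : ℝ, ∀ n, ‖((x n : H))‖ ≤ C) → (∃ C : ℝ, ∀ n, ‖T (x n)‖ ≤ C) →
    ∃ (φ : ℕ → ℕ) (y : H), StrictMono φ ∧
      Tendsto (fun n => S (Submodule.inclusion h (x (φ n)))) atTop (nhds y)

/-- The sum `T + S` of two linear operators in `H`, with domain `dom T ∩ dom S`. -/
def pmapAdd (T S : H →ₗ.[ℂ] H) : H →ₗ.[ℂ] H :=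
  { domain := T.domain ⊓ S.domain
    toFun := T.toFun.comp (Submodule.inclusion inf_le_left) +
      S.toFun.comp (Submodule.inclusion inf_le_right) }


structure SAOp (D : Submodule ℂ H) (T : D →ₗ[ℂ] H) : Prop where
  dense : Dense (D : Set H)
  symm : ∀ x y : D, (inner ℂ (T x) (y : H) : ℂ) = inner ℂ (x : H) (T y)
  max : ∀ y z : H, (∀ x : D, (inner ℂ (T x) y : ℂ) = inner ℂ (x : H) z) →
    ∃ h : y ∈ D, T ⟨y, h⟩ = z

structure RCOp (D : Submodule ℂ H) (S T : D →ₗ[ℂ] H) : Prop where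
  symm : ∀ x y : D, (inner ℂ (S x) (y : H) : ℂ) = inner ℂ (x : H) (S y)
  comp : ∀ x : ℕ → D, (∃ C : ℝ, ∀ n, ‖(x n : H)‖ ≤ C) → (∃ C : ℝ, ∀ n, ‖T (x n)‖ ≤ C) →
    ∃ (φ : ℕ → ℕ) (y : H), StrictMono φ ∧ Tendsto (fun n => S (x (φ n))) atTop (nhds y)

def qf {D : Submodule ℂ H} (T : D →ₗ[ℂ] H) (x : D) : ℝ := (inner ℂ (x : H) (T x) : ℂ).re

variable {D : Submodule ℂ H} {S T : D →ₗ[ℂ] H}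

omit [CompleteSpace H] in
lemma qf_add (hs : ∀ x y : D, (inner ℂ (T x) (y : H) : ℂ) = inner ℂ (x : H) (T y)) (x y : D) :
    qf T (x + y) = qf T x + qf T y + 2 * (inner ℂ (T x) (y : H) : ℂ).re := by
  have h : (inner ℂ (y : H) (T x) : ℂ).re = (inner ℂ (T x) (y : H) : ℂ).re := by
    rw [← inner_conj_symm, Complex.conj_re]
  simp only [qf, map_add, Submodule.coe_add, inner_add_left, inner_add_right, Complex.add_re, h,
    ← hs x y]
  ring

omit [CompleteSpace H] in
lemma qf_im (hs : ∀ x y : D, (inner ℂ (T x) (y : H) : ℂ) = inner ℂ (x : H) (T y)) (x : D) :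
    (inner ℂ (x : H) (T x) : ℂ) = (qf T x : ℂ) := by
  have h := hs x x
  rw [← inner_conj_symm] at h
  exact (Complex.conj_eq_iff_re.mp h).symm

omit [CompleteSpace H] in
lemma qf_smul (c : ℝ) (x : D) : qf T ((c : ℂ) • x) = c ^ 2 * qf T x := by
  simp only [qf, map_smul, Submodule.coe_smul, inner_smul_left, inner_smul_right, Complex.conj_ofReal,
    ← mul_assoc, ← Complex.ofReal_mul, Complex.re_ofReal_mul]
  ring

omit [CompleteSpace H] in
lemma dense_inner_zero (hD : Dense (D : Set H)) (y : H)
    (h : ∀ u : D, (inner ℂ y (u : H) : ℂ) = 0) : y = 0 :=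
  hD.eq_zero_of_inner_left ℂ fun v hv => h ⟨v, hv⟩

omit [CompleteSpace H] in
/-- subsequence limits of `S x_n` vanish when `x_n` is weakly null -/
lemma lim_zero (hD : Dense (D : Set H)) (hS : RCOp D S T) (x : ℕ → D)
    (hx : WeakNull fun n => (x n : H)) (y : H)
    (hy : Tendsto (fun n => S (x n)) atTop (nhds y)) : y = 0 := by
  refine dense_inner_zero hD y fun u => ?_
  have h1 : Tendsto (fun n => (inner ℂ (S (x n)) (u : H) : ℂ)) atTop (nhds (inner ℂ y (u : H))) :=
    hy.inner tendsto_const_nhds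
  have h2 := hx (S u)
  simp only [← hS.symm] at h2
  exact tendsto_nhds_unique h1 h2

omit [CompleteSpace H] in
lemma WeakNull.subseq {x : ℕ → H} (hx : WeakNull x) {φ : ℕ → ℕ} (hφ : Tendsto φ atTop atTop) :
    WeakNull (fun n => x (φ n)) := fun y => (hx y).comp hφ

omit [CompleteSpace H] in
lemma comp_null (hD : Dense (D : Set H)) (hS : RCOp D S T) (x : ℕ → D)
    (hx : WeakNull fun n => (x n : H)) (hb : ∃ C : ℝ, ∀ n, ‖(x n : H)‖ ≤ C)
    (hb2 : ∃ C : ℝ, ∀ n, ‖T (x n)‖ ≤ C) : Tendsto (fun n => S (x n)) atTop (nhds 0) := by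
  refine tendsto_of_subseq_tendsto fun ns hns => ?_
  obtain ⟨φ, y, hφ, hy⟩ := hS.comp (fun n => x (ns n)) (hb.imp fun C h n => h _)
    (hb2.imp fun C h n => h _)
  refine ⟨φ, ?_⟩
  have := lim_zero hD hS (fun n => x (ns (φ n)))
    ((hx.subseq hns).subseq hφ.tendsto_atTop) y hy
  rwa [this] at hy

omit [CompleteSpace H] in
lemma rel_bound (hD : Dense (D : Set H)) (hS : RCOp D S T) {ε : ℝ} (hε : 0 < ε) :
    ∃ C : ℝ, 0 < C ∧ ∀ x : D, ‖S x‖ ≤ ε * ‖T x‖ + C * ‖(x : H)‖ := by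
  by_contra! hcon
  have hcon' : ∀ n : ℕ, ∃ x : D, ‖S x‖ = 1 ∧ ‖T x‖ ≤ 1 / ε ∧ ‖(x : H)‖ ≤ 1 / ((n : ℝ) + 1) := by
    intro n
    obtain ⟨x, hx⟩ := hcon ((n : ℝ) + 1) (by positivity)
    have hpos : 0 < ‖S x‖ := lt_of_le_of_lt (by positivity) hx
    have e1 : ε * ‖T x‖ ≤ ‖S x‖ := by
      have : 0 ≤ ((n : ℝ) + 1) * ‖(x : H)‖ := by positivity
      linarith
    have e2 : ((n : ℝ) + 1) * ‖(x : H)‖ ≤ ‖S x‖ := by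
      have : 0 ≤ ε * ‖T x‖ := by positivity
      linarith
    have hn : (0 : ℝ) < (n : ℝ) + 1 := by positivity
    refine ⟨((‖S x‖⁻¹ : ℝ) : ℂ) • x, ?_, ?_, ?_⟩
    · rw [map_smul, norm_smul]; simp; field_simp
    · rw [map_smul, norm_smul]; simp only [Complex.norm_real, norm_inv, norm_norm]
      rw [inv_mul_le_iff₀ hpos, mul_one_div, le_div_iff₀ hε]; linarith
    · rw [Submodule.coe_smul, norm_smul]; simp only [Complex.norm_real, norm_inv, norm_norm]
      rw [inv_mul_le_iff₀ hpos, mul_one_div, le_div_iff₀ hn]; linarith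
  choose x h1 h2 h3 using hcon'
  have hx0 : Tendsto (fun n => (x n : H)) atTop (nhds 0) :=
    squeeze_zero_norm h3 tendsto_one_div_add_atTop_nhds_zero_nat
  have hw : WeakNull fun n => (x n : H) := fun y => by
    simpa using hx0.inner (tendsto_const_nhds (x := y))
  have := (comp_null hD hS x hw ⟨1, fun n => (h3 n).trans (by
    rw [div_le_one (by positivity)]; simp)⟩ ⟨_, h2⟩).norm
  simp only [h1, norm_zero] at this
  exact one_ne_zero (tendsto_nhds_unique tendsto_const_nhds this)

/-- `T + c` as a linear map on `D` -/
def shiftOp (T : D →ₗ[ℂ] H) (c : ℂ) : D →ₗ[ℂ] H := T + c • D.subtype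

omit [CompleteSpace H] in
@[simp] lemma shiftOp_apply (c : ℂ) (x : D) : shiftOp T c x = T x + c • (x : H) := rfl

lemma SAOp.surj (hT : SAOp D T) (c : ℂ) (δ : ℝ) (hδ : 0 < δ)
    (h1 : ∀ x : D, δ * ‖(x : H)‖ ≤ ‖shiftOp T c x‖)
    (h2 : ∀ x : D, δ * ‖(x : H)‖ ≤ ‖shiftOp T (starRingEnd ℂ c) x‖) :
    Function.Surjective (shiftOp T c) := by
  rw [← LinearMap.range_eq_top]
  have hcl : IsClosed ((LinearMap.range (shiftOp T c) : Submodule ℂ H) : Set H) := by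
    refine isClosed_of_closure_subset fun w hw => ?_
    obtain ⟨v, hv, hvw⟩ := mem_closure_iff_seq_limit.mp hw
    choose x hx using hv
    have hxc : CauchySeq (fun n => (x n : H)) := by
      have hvc := hvw.cauchySeq
      rw [Metric.cauchySeq_iff] at hvc ⊢
      intro ε hε
      obtain ⟨N, hN⟩ := hvc (δ * ε) (by positivity)
      refine ⟨N, fun m hm n hn => ?_⟩
      have h3 := hN m hm n hn
      rw [dist_eq_norm, ← hx, ← hx, ← map_sub] at h3
      have h4 := h1 (x m - x n)
      rw [dist_eq_norm, ← Submodule.coe_sub]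
      exact lt_of_mul_lt_mul_left (h4.trans_lt h3) hδ.le
    obtain ⟨x0, hx0⟩ := cauchySeq_tendsto_of_complete hxc
    have hTx : Tendsto (fun n => T (x n)) atTop (nhds (w - c • x0)) := by
      have : (fun n => T (x n)) = fun n => v n - c • (x n : H) := by
        funext n; rw [← hx n]; simp
      rw [this]; exact hvw.sub (hx0.const_smul c)
    obtain ⟨hD, e⟩ := hT.max x0 (w - c • x0) fun u => by
      have a1 : Tendsto (fun n => (inner ℂ (T u) (x n : H) : ℂ)) atTop (nhds (inner ℂ (T u) x0)) :=
        tendsto_const_nhds.inner hx0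
      have a2 : Tendsto (fun n => (inner ℂ (u : H) (T (x n)) : ℂ)) atTop
        (nhds (inner ℂ (u : H) (w - c • x0))) := tendsto_const_nhds.inner hTx
      simp only [hT.symm] at a1
      exact tendsto_nhds_unique (by simpa only [hT.symm] using a1) a2
    exact ⟨⟨x0, hD⟩, by simp [e]⟩
  have := hcl.completeSpace_coe
  rw [← Submodule.orthogonal_eq_bot_iff, eq_bot_iff]
  intro y hy
  rw [Submodule.mem_orthogonal] at hy
  obtain ⟨hD, e⟩ := hT.max y (-(starRingEnd ℂ c) • y) fun u => by
    have := hy (shiftOp T c u) ⟨u, rfl⟩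
    simp only [shiftOp_apply, inner_add_left, inner_smul_left] at this
    simp only [neg_smul, inner_neg_right, inner_smul_right]
    linear_combination this
  have := h2 ⟨y, hD⟩
  simp only [shiftOp_apply, e, neg_smul, neg_add_cancel, norm_zero] at this
  have h0 : ‖y‖ = 0 := by
    have := norm_nonneg y
    nlinarith
  simpa using h0

omit [CompleteSpace H] in
lemma norm_shift_I (hs : ∀ x y : D, (inner ℂ (T x) (y : H) : ℂ) = inner ℂ (x : H) (T y))
    (N : ℝ) (x : D) :
    ‖shiftOp T (N * Complex.I) x‖ ^ 2 = ‖T x‖ ^ 2 + N ^ 2 * ‖(x : H)‖ ^ 2 := by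
  rw [shiftOp_apply, @norm_add_sq ℂ, inner_smul_right, hs, qf_im hs]
  rw [norm_smul]; simp [mul_pow]

omit [CompleteSpace H] in
lemma norm_shift_real (hp : ∀ x, 0 ≤ qf T x)
    (hs : ∀ x y : D, (inner ℂ (T x) (y : H) : ℂ) = inner ℂ (x : H) (T y)) 
    (N : ℝ) (hN : 0 ≤ N) (x : D) :
    ‖T x‖ ^ 2 + N ^ 2 * ‖(x : H)‖ ^ 2 ≤ ‖shiftOp T N x‖ ^ 2  := by
  rw [shiftOp_apply, @norm_add_sq ℂ, inner_smul_right, hs, qf_im hs]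
  rw [norm_smul]; simp [mul_pow]
  exact mul_nonneg hN (hp x)

lemma norm_le_of_sq {a b c : ℝ} (hc : 0 ≤ c)
    (h : a ^ 2 + b ^ 2 ≤ c ^ 2) : a ≤ c ∧ b ≤ c :=
  ⟨abs_le_of_sq_le_sq' (by nlinarith) hc |>.2, abs_le_of_sq_le_sq' (by nlinarith) hc |>.2⟩

omit [CompleteSpace H] in
lemma norm_shift_real' (hp : ∀ x, 0 ≤ qf T x)
    (hs : ∀ x y : D, (inner ℂ (T x) (y : H) : ℂ) = inner ℂ (x : H) (T y))
    (N : ℝ) (hN : 0 ≤ N) (x : D) :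
    ‖T x‖ ≤ ‖shiftOp T N x‖ ∧ N * ‖(x : H)‖ ≤ ‖shiftOp T N x‖ := by
  refine norm_le_of_sq (norm_nonneg _) ?_
  rw [mul_pow]
  exact norm_shift_real hp hs N hN x

omit [CompleteSpace H] in
lemma RCOp.neg_left (hS : RCOp D S T) : RCOp D (-S) T where
  symm x y := by simp [hS.symm]
  comp x h1 h2 := by
    obtain ⟨φ, y, hφ, hy⟩ := hS.comp x h1 h2
    exact ⟨φ, -y, hφ, hy.neg⟩

omit [CompleteSpace H] in
lemma RCOp.neg_right (hS : RCOp D S T) : RCOp D S (-T) where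
  symm := hS.symm
  comp x h1 h2 := hS.comp x h1 (by simpa using h2)

omit [CompleteSpace H] in
lemma SAOp.neg (hT : SAOp D T) : SAOp D (-T) where
  dense := hT.dense
  symm x y := by simp [hT.symm]
  max y z h := by
    obtain ⟨hD, e⟩ := hT.max y (-z) fun x => by
      have := h x
      simp only [LinearMap.neg_apply, inner_neg_left] at this
      simp [← this]
    exact ⟨hD, by simp [e]⟩

omit [CompleteSpace H] in
lemma RCOp.perturb (hD : Dense (D : Set H)) (hS : RCOp D S T) : RCOp D (-S) (T + S) where
  symm := hS.neg_left.symm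
  comp x h1 h2 := by
    refine hS.neg_left.comp x h1 ?_
    obtain ⟨C, hC, hb⟩ := rel_bound hD hS (ε := 1 / 2) (by norm_num)
    obtain ⟨C1, h1⟩ := h1
    obtain ⟨C2, h2⟩ := h2
    refine ⟨2 * (C2 + C * C1), fun n => ?_⟩
    have a1 := hb (x n)
    have a2 : ‖T (x n)‖ ≤ ‖(T + S) (x n)‖ + ‖S (x n)‖ := by
      have := norm_sub_le ((T + S) (x n)) (S (x n))
      simpa using this
    have a3 := h2 n
    have a4 := mul_le_mul_of_nonneg_left (h1 n) hC.le
    linarith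

/-- Kato–Rellich -/
lemma SAOp.perturb (hT : SAOp D T) (hS : RCOp D S T) : SAOp D (T + S) := by
  have hsym : ∀ x y : D, (inner ℂ ((T + S) x) (y : H) : ℂ) = inner ℂ (x : H) ((T + S) y) := by
    intro x y
    simp [inner_add_left, inner_add_right, hT.symm, hS.symm]
  refine ⟨hT.dense, hsym, fun y z hyz => ?_⟩
  obtain ⟨C, hC, hb⟩ := rel_bound hT.dense hS (ε := 1 / 4) (by norm_num)
  have key : ∀ N : ℝ, |N| = 4 * C → Function.Surjective (shiftOp (T + S) (N * Complex.I)) := by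
    intro N hN
    have hN2 : N ^ 2 = (4 * C) ^ 2 := by rw [← hN, sq_abs]
    have hlow : ∀ M : ℝ, M ^ 2 = (4 * C) ^ 2 → ∀ x : D, ‖T x‖ ≤ ‖shiftOp T (M * Complex.I) x‖ ∧
        4 * C * ‖(x : H)‖ ≤ ‖shiftOp T (M * Complex.I) x‖ := fun M hM x =>
      norm_le_of_sq (norm_nonneg _) (by rw [norm_shift_I hT.symm, hM, mul_pow])
    have hsurj : Function.Surjective (shiftOp T (N * Complex.I)) := by
      refine hT.surj _ (4 * C) (by positivity) (fun x => (hlow N hN2 x).2) fun x => ?_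
      have := (hlow (-N) (by rw [neg_sq, hN2]) x).2
      simpa using this
    have hinj : Function.Injective (shiftOp T (N * Complex.I)) := by
      rw [← LinearMap.ker_eq_bot, eq_bot_iff]
      intro x hx
      have h := (hlow N hN2 x).2
      rw [LinearMap.mem_ker] at hx
      rw [hx, norm_zero] at h
      have : ‖(x : H)‖ = 0 := by
        have := norm_nonneg (x : H)
        nlinarith
      simpa using this
    let e := LinearEquiv.ofBijective _ ⟨hinj, hsurj⟩
    have he : ∀ w, shiftOp T (N * Complex.I) (e.symm w) = w := fun w => e.apply_symm_apply w
    let K : H →L[ℂ] H := LinearMap.mkContinuous (-(S ∘ₗ e.symm.toLinearMap)) (1 / 2) (by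
      intro w
      have h1 := hb (e.symm w)
      have h2 := hlow N hN2 (e.symm w)
      rw [he] at h2
      simp only [LinearMap.neg_apply, norm_neg, LinearMap.comp_apply, LinearEquiv.coe_coe]
      linarith [h2.1, h2.2])
    have hK : ‖K‖ < 1 := lt_of_le_of_lt (LinearMap.mkContinuous_norm_le _ (by norm_num) _)
      (by norm_num)
    obtain ⟨u, hu⟩ := isUnit_one_sub_of_norm_lt_one hK
    intro w
    refine ⟨e.symm ((↑u⁻¹ : H →L[ℂ] H) w), ?_⟩
    have h3 : (1 - K) ((↑u⁻¹ : H →L[ℂ] H) w) = w := by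
      rw [← hu, ← mul_apply_eq_comp, u.mul_inv]; rfl
    have h4 := he ((↑u⁻¹ : H →L[ℂ] H) w)
    have h5 : ∀ v, K v = -S (e.symm v) := fun v => rfl
    rw [sub_apply, h5, one_apply_eq_self] at h3
    have h6 : ∀ v, shiftOp (T + S) (N * Complex.I) (e.symm v) =
        shiftOp T (N * Complex.I) (e.symm v) - -S (e.symm v) := by
      intro v
      simp only [shiftOp_apply, LinearMap.add_apply]
      abel
    rw [h6, h4, h3]
  obtain ⟨N, hN⟩ : ∃ N : ℝ, N = 4 * C := ⟨_, rfl⟩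
  rw [← hN] at key
  have hN0 : 0 < N := by rw [hN]; positivity
  obtain ⟨x0, hx0⟩ := key N (abs_of_pos hN0) (z + ((N : ℂ) * Complex.I) • y)
  have : y - x0 = 0 := by
    rw [← inner_self_eq_zero (𝕜 := ℂ)]
    obtain ⟨v, hv⟩ := key (-N) (by rw [abs_neg, abs_of_pos hN0]) (y - x0)
    nth_rewrite 1 [← hv]
    have a1 := hyz v
    have a2 := hsym v x0
    have a3 : (inner ℂ (v : H) (shiftOp (T + S) ((N : ℂ) * Complex.I) x0) : ℂ) = 
      inner ℂ (v : H) (z + ((N : ℂ) * Complex.I) • y) := by rw [hx0]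
    simp only [shiftOp_apply, inner_add_left, inner_add_right, inner_sub_right, inner_smul_left, inner_smul_right] at a3 ⊢
    rw [a1, a2]
    simp only [map_mul, map_neg, Complex.conj_ofReal, Complex.conj_I, Complex.ofReal_neg]
    linear_combination -a3
  have hy : y = x0 := sub_eq_zero.mp this
  subst hy
  refine ⟨x0.2, ?_⟩
  simpa using hx0

omit [CompleteSpace H] in
lemma qf_cs (hs : ∀ x y : D, (inner ℂ (T x) (y : H) : ℂ) = inner ℂ (x : H) (T y))
    (hp : ∀ x, 0 ≤ qf T x) (x y : D) :
    (inner ℂ (T x) (y : H) : ℂ).re ^ 2 ≤ qf T x * qf T y := by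
  have h : ∀ t : ℝ, 0 ≤ qf T y * (t * t) + (2 * (inner ℂ (T x) (y : H) : ℂ).re) * t + qf T x := by
    intro t
    have := hp (x + (t : ℂ) • y)
    rw [qf_add hs, qf_smul] at this
    simp only [Submodule.coe_smul, inner_smul_right, Complex.re_ofReal_mul] at this
    linarith
  have := discrim_le_zero h
  rw [discrim] at this
  linarith

lemma logconvex_bound (a : ℕ → ℝ) (C ε : ℝ) (hε : 0 < ε) (h0 : ∀ n, 0 ≤ a n)
    (hlc : ∀ n, a (n + 1) ^ 2 ≤ a n * a (n + 2)) (hb : ∀ n, a n ≤ C * ε ^ n) :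
    a 1 ≤ ε * a 0 := by
  by_contra! hcon
  have h1 : 0 < a 1 := lt_of_le_of_lt (mul_nonneg hε.le (h0 0)) hcon
  have h00 : 0 < a 0 := by
    have := hlc 0
    by_contra! h
    have : a 0 = 0 := le_antisymm h (h0 0)
    simp only [this, zero_add, zero_mul] at *
    nlinarith
  obtain ⟨r, hr⟩ : ∃ r, r = a 1 / a 0 := ⟨_, rfl⟩
  have hrε : ε < r := by rw [hr, lt_div_iff₀ h00]; exact hcon
  have hr0 : 0 < r := hε.trans hrε
  have step : ∀ n, 0 < a n ∧ r * a n ≤ a (n + 1) := by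
    intro n
    induction n with
    | zero => exact ⟨h00, by rw [hr]; field_simp; simp⟩
    | succ n ih =>
      have hp : 0 < a (n + 1) := lt_of_lt_of_le (mul_pos hr0 ih.1) ih.2
      refine ⟨hp, ?_⟩
      have h2 := hlc n
      have h3 : r * a n * a (n + 1) ≤ a (n + 1) * a (n + 1) :=
        mul_le_mul_of_nonneg_right ih.2 hp.le
      have : a n * (r * a (n + 1)) ≤ a n * a (n + 2) := by nlinarith
      exact le_of_mul_le_mul_left this ih.1
  have hpow : ∀ n, a 0 * r ^ n ≤ a n := by
    intro n
    induction n with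
    | zero => simp
    | succ n ih =>
      calc a 0 * r ^ (n + 1) = r * (a 0 * r ^ n) := by ring
        _ ≤ r * a n := by gcongr
        _ ≤ _ := (step n).2
  have hlim := tendsto_pow_atTop_atTop_of_one_lt ((one_lt_div hε).mpr hrε)
  obtain ⟨n, hn⟩ := (hlim.eventually_gt_atTop (C / a 0)).exists
  have := (hpow n).trans (hb n)
  rw [div_pow, div_lt_div_iff₀ h00 (by positivity)] at hn
  linarith

/-- Heinz / Lax type inequality -/
lemma form_bound (hs : ∀ x y : D, (inner ℂ (T x) (y : H) : ℂ) = inner ℂ (x : H) (T y))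
    (hsS : ∀ x y : D, (inner ℂ (S x) (y : H) : ℂ) = inner ℂ (x : H) (S y))
    (hp : ∀ x : D, ‖(x : H)‖ ^ 2 ≤ qf T x) (hsurj : Function.Surjective T)
    (ε : ℝ) (hε : 0 < ε) (hb : ∀ x, ‖S x‖ ≤ ε * ‖T x‖) (x : D) :
    |qf S x| ≤ ε * qf T x := by
  have hp0 : ∀ x, 0 ≤ qf T x := fun x => (sq_nonneg _).trans (hp x)
  choose L hL using fun x : D => hsurj (S x)
  have hqle : ∀ x, qf T x ≤ ‖T x‖ ^ 2 := by
    intro x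
    have h1 : qf T x ≤ ‖(x : H)‖ * ‖T x‖ := (Complex.re_le_norm _).trans (norm_inner_le_norm _ _)
    have h2 := hp x
    have h3 := sq_nonneg (‖(x : H)‖ - ‖T x‖)
    nlinarith
  have hTL : ∀ n, ‖T (L^[n] x)‖ ≤ ε ^ n * ‖T x‖ := by
    intro n
    induction n with
    | zero => simp
    | succ n ih =>
      rw [Function.iterate_succ_apply', hL]
      calc _ ≤ ε * ‖T (L^[n] x)‖ := hb _
        _ ≤ ε * (ε ^ n * ‖T x‖) := by gcongr
        _ = _ := by ring
  have hmid : ∀ y, qf T (L y) ^ 2 ≤ qf T y * qf T (L (L y)) := by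
    intro y
    have h1 := qf_cs hs hp0 (L (L y)) y
    rw [hL, hsS, ← hL y] at h1
    rw [mul_comm]; exact h1
  have hmain := logconvex_bound (fun n => qf T (L^[n] x)) (‖T x‖ ^ 2) (ε ^ 2) (by positivity)
    (fun n => hp0 _) (fun n => by
      simp only [Function.iterate_succ_apply']; exact hmid _) (fun n => by
      refine (hqle _).trans ?_
      calc _ ≤ (ε ^ n * ‖T x‖) ^ 2 := by gcongr; exact hTL n
        _ = _ := by ring)
  simp only [Function.iterate_succ_apply', Function.iterate_zero, id] at hmain
  refine abs_le_of_sq_le_sq ?_ (mul_nonneg hε.le (hp0 x))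
  have h1 := qf_cs hs hp0 (L x) x
  rw [hL, hsS] at h1
  calc qf S x ^ 2 ≤ _ := h1
    _ ≤ ε ^ 2 * qf T x * qf T x := by gcongr; exact hp0 x
    _ = _ := by ring

omit [CompleteSpace H] in
lemma qf_shift (c : ℝ) (x : D) : qf (shiftOp T c) x = qf T x + c * ‖(x : H)‖ ^ 2 := by
  simp only [qf, shiftOp_apply, inner_add_right, inner_smul_right, Complex.add_re,
    Complex.re_ofReal_mul]
  rw [inner_self_eq_norm_sq_to_K]
  norm_cast

omit [CompleteSpace H] in
lemma shift_symm (hs : ∀ x y : D, (inner ℂ (T x) (y : H) : ℂ) = inner ℂ (x : H) (T y)) (c : ℝ) :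
    ∀ x y : D, (inner ℂ (shiftOp T c x) (y : H) : ℂ) = inner ℂ (x : H) (shiftOp T c y) := by
  intro x y
  simp [inner_add_left, inner_add_right, inner_smul_left, inner_smul_right, hs]

omit [CompleteSpace H] in
lemma SAOp.shift (hT : SAOp D T) (c : ℝ) : SAOp D (shiftOp T c) where
  dense := hT.dense
  symm := shift_symm hT.symm c
  max y z h := by
    obtain ⟨hD, e⟩ := hT.max y (z - (c : ℂ) • y) fun x => by
      have := h x
      simp only [shiftOp_apply, inner_add_left, inner_smul_left, Complex.conj_ofReal] at this
      simp only [inner_sub_right, inner_smul_right]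
      linear_combination this
    exact ⟨hD, by simp [e]⟩

omit [CompleteSpace H] in
lemma RCOp.shift (hS : RCOp D S T) (c : ℝ) : RCOp D S (shiftOp T c) where
  symm := hS.symm
  comp x h1 h2 := hS.comp x h1 (by
    obtain ⟨C1, h1⟩ := h1
    obtain ⟨C2, h2⟩ := h2
    refine ⟨C2 + |c| * C1, fun n => ?_⟩
    have a2 : ‖T (x n)‖ ≤ ‖shiftOp T c (x n)‖ + ‖(c : ℂ) • (x n : H)‖ := by
      have := norm_sub_le (shiftOp T c (x n)) ((c : ℂ) • (x n : H))
      simpa using this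
    rw [norm_smul, Complex.norm_real, Real.norm_eq_abs] at a2
    have := mul_le_mul_of_nonneg_left (h1 n) (abs_nonneg c)
    linarith [h2 n])

lemma SAOp.surj_pos (hT : SAOp D T) (hp : ∀ x, 0 ≤ qf T x) (N : ℝ) (hN : 0 < N) :
    Function.Surjective (shiftOp T N) := by
  have : ∀ x : D, N * ‖(x : H)‖ ≤ ‖shiftOp T N x‖ := fun x =>
    (norm_shift_real' hp hT.symm N hN.le x).2
  exact hT.surj N N hN this (by simpa using this)

/-- relative form bound zero -/
lemma form_rel (hT : SAOp D T) (hS : RCOp D S T) (hp : ∀ x, 0 ≤ qf T x) (ε : ℝ) (hε : 0 < ε) :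
    ∃ N : ℝ, 0 < N ∧ ∀ x, |qf S x| ≤ ε * (qf T x + N * ‖(x : H)‖ ^ 2) := by
  obtain ⟨C, hC, hb⟩ := rel_bound hT.dense hS (ε := ε / 2) (by positivity)
  refine ⟨2 * C / ε + 1, by positivity, fun x => ?_⟩
  have hN : 0 < 2 * C / ε + 1 := by positivity
  rw [← qf_shift]
  refine form_bound (shift_symm hT.symm _) hS.symm (fun x => ?_) (hT.surj_pos hp _ hN) ε hε
    (fun x => ?_) x
  · rw [qf_shift]
    have := hp x
    have h2 : 0 ≤ 2 * C / ε * ‖(x : H)‖ ^ 2 := by positivity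
    linarith
  · have h1 := norm_shift_real' hp hT.symm _ hN.le x
    have h2 := hb x
    have h3 : C * ‖(x : H)‖ ≤ ε / 2 * ((2 * C / ε + 1) * ‖(x : H)‖) := by
      have : ε / 2 * ((2 * C / ε + 1) * ‖(x : H)‖) = C * ‖(x : H)‖ + ε / 2 * ‖(x : H)‖ := by
        field_simp
      rw [this]
      have : 0 ≤ ε / 2 * ‖(x : H)‖ := by positivity
      linarith
    have h4 := mul_le_mul_of_nonneg_left h1.1 (by positivity : 0 ≤ ε / 2)
    have h5 := mul_le_mul_of_nonneg_left h1.2 (by positivity : 0 ≤ ε / 2)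
    linarith

/-- form compactness, nonnegative case -/
lemma form_null (hT : SAOp D T) (hS : RCOp D S T) (hp : ∀ x, 0 ≤ qf T x) (x : ℕ → D)
    (hx : WeakNull fun n => (x n : H)) (C1 C2 : ℝ) (h1 : ∀ n, ‖(x n : H)‖ ≤ C1)
    (h2 : ∀ n, qf T (x n) ≤ C2) : Tendsto (fun n => qf S (x n)) atTop (nhds 0) := by
  have hC2 : 0 ≤ C2 := (hp _).trans (h2 0)
  have hC1 : 0 ≤ C1 := (norm_nonneg _).trans (h1 0)
  rw [Metric.tendsto_atTop]
  intro η hη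
  obtain ⟨ε, hε⟩ : ∃ ε, ε = η / (4 * (C2 + 1)) := ⟨_, rfl⟩
  have hε0 : 0 < ε := by rw [hε]; positivity
  obtain ⟨N, hN, hform⟩ := form_rel hT hS hp ε hε0
  choose y hy using fun n => hT.surj_pos hp N hN ((N : ℂ) • (x n : H))
  have hyb : ∀ n, ‖(y n : H)‖ ≤ C1 := by
    intro n
    have h := (norm_shift_real' hp hT.symm N hN.le (y n)).2
    rw [hy, norm_smul, Complex.norm_real, Real.norm_of_nonneg hN.le] at h
    exact (le_of_mul_le_mul_left h hN).trans (h1 n)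
  have hzb : ∀ n, ‖((x n - y n : D) : H)‖ ≤ 2 * C1 := by
    intro n
    have := norm_sub_le (x n : H) (y n : H)
    rw [Submodule.coe_sub]
    linarith [h1 n, hyb n]
  have hTy : ∀ n, T (y n) = (N : ℂ) • ((x n - y n : D) : H) := by
    intro n
    have := hy n
    rw [shiftOp_apply] at this
    rw [Submodule.coe_sub, smul_sub, ← this]; abel
  have hyw : WeakNull fun n => (y n : H) := by
    intro u
    obtain ⟨v, hv⟩ := hT.surj_pos hp N hN ((N : ℂ) • u)
    have hNc : (N : ℂ) ≠ 0 := by exact_mod_cast hN.ne'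
    have e : ∀ n, (inner ℂ (y n : H) u : ℂ) = inner ℂ (x n : H) (v : H) := by
      intro n
      have a := shift_symm hT.symm N (y n) v
      rw [hv, hy, inner_smul_left, inner_smul_right, Complex.conj_ofReal] at a
      exact (mul_left_cancel₀ hNc a).symm
    simp only [e]
    exact hx v
  have hSy := comp_null hT.dense hS y hyw ⟨C1, hyb⟩ ⟨N * (2 * C1), fun n => by
    rw [hTy, norm_smul, Complex.norm_real, Real.norm_of_nonneg hN.le]
    exact mul_le_mul_of_nonneg_left (hzb n) hN.le⟩
  rw [Metric.tendsto_atTop] at hSy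
  obtain ⟨n0, hn0⟩ := hSy (η / (10 * (C1 + 1))) (by positivity)
  refine ⟨n0, fun n hn => ?_⟩
  have hs := hn0 n hn
  rw [dist_zero_right] at hs
  rw [Real.dist_eq, sub_zero]
  obtain ⟨z, hz⟩ : ∃ z, z = x n - y n := ⟨_, rfl⟩
  have hxz : x n = y n + z := by rw [hz]; abel
  have hzn := hzb n
  have hTyn := hTy n
  rw [← hz] at hzn hTyn
  have e1 : qf T (x n) = qf T (y n) + qf T z + 2 * (N * ‖(z : H)‖ ^ 2) := by
    rw [hxz, qf_add hT.symm, hTyn, inner_smul_left, Complex.conj_ofReal, Complex.re_ofReal_mul,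
      inner_self_eq_norm_sq_to_K]
    norm_cast
  have e2 : qf S (x n) = qf S (y n) + qf S z + 2 * (inner ℂ (S (y n)) (z : H) : ℂ).re := by
    rw [hxz, qf_add hS.symm]
  have b1 : |qf S z| ≤ ε * C2 := by
    refine (hform z).trans (mul_le_mul_of_nonneg_left ?_ hε0.le)
    have := hp (y n)
    have := h2 n
    have : 0 ≤ N * ‖(z : H)‖ ^ 2 := by positivity
    linarith
  have b2 : |qf S (y n)| ≤ ‖S (y n)‖ * C1 := by
    refine (Complex.abs_re_le_norm _).trans ((norm_inner_le_norm _ _).trans ?_)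
    rw [mul_comm]
    exact mul_le_mul_of_nonneg_left (hyb n) (norm_nonneg _)
  have b3 : |(inner ℂ (S (y n)) (z : H) : ℂ).re| ≤ ‖S (y n)‖ * (2 * C1) := by
    refine (Complex.abs_re_le_norm _).trans ((norm_inner_le_norm _ _).trans ?_)
    exact mul_le_mul_of_nonneg_left hzn (norm_nonneg _)
  have b4 : ε * C2 ≤ η / 4 := by
    rw [hε, div_mul_eq_mul_div, div_le_div_iff₀ (by positivity) (by positivity)]
    nlinarith
  have b5 : ‖S (y n)‖ * C1 ≤ η / 10 := by
    calc _ ≤ η / (10 * (C1 + 1)) * C1 := by gcongr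
      _ ≤ η / 10 := by
        rw [div_mul_eq_mul_div, div_le_div_iff₀ (by positivity) (by positivity)]
        nlinarith
  rw [abs_le] at b1 b2 b3
  rw [e2, abs_lt]
  constructor <;> linarith [b1.1, b1.2, b2.1, b2.2, b3.1, b3.2]

def BddBel (T : D →ₗ[ℂ] H) : Prop := ∃ c : ℝ, ∀ x : D, c * ‖(x : H)‖ ^ 2 ≤ qf T x

omit [CompleteSpace H] in
lemma qf_sum (x : D) : qf (T + S) x = qf T x + qf S x := by
  simp [qf, inner_add_right]

omit [CompleteSpace H] in
lemma qf_neg (x : D) : qf (-T) x = - qf T x := by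
  simp [qf]

lemma form_null' (hT : SAOp D T) (hS : RCOp D S T) (hp : BddBel T) (x : ℕ → D)
    (hx : WeakNull fun n => (x n : H)) (h1 : ∀ n, ‖(x n : H)‖ = 1) (C2 : ℝ)
    (h2 : ∀ n, qf T (x n) ≤ C2) : Tendsto (fun n => qf S (x n)) atTop (nhds 0) := by
  obtain ⟨c, hc⟩ := hp
  refine form_null (hT.shift (-c)) (hS.shift (-c)) (fun x => ?_) x hx 1 (C2 - c)
    (fun n => (h1 n).le) (fun n => ?_)
  · rw [qf_shift]; linarith [hc x]
  · rw [qf_shift, h1]; linarith [h2 n]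

lemma BddBel.perturb (hT : SAOp D T) (hS : RCOp D S T) (hp : BddBel T) : BddBel (T + S) := by
  obtain ⟨c, hc⟩ := hp
  obtain ⟨N, hN, h⟩ := form_rel (hT.shift (-c)) (hS.shift (-c)) (fun x => by
    rw [qf_shift]; linarith [hc x]) (1 / 2) (by norm_num)
  refine ⟨c - N / 2, fun x => ?_⟩
  have h1 := (abs_le.mp (h x)).1
  rw [qf_shift] at h1
  rw [qf_sum]
  linarith [hc x]

omit [CompleteSpace H] in
lemma unbdd_step (hs : ∀ x y : D, (inner ℂ (T x) (y : H) : ℂ) = inner ℂ (x : H) (T y))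
    (hu : ¬ BddBel (-T)) (d : D) (hd : qf T d ≤ 0) (ε : ℝ) (hε : 0 < ε) :
    ∃ v : D, ‖(v : H)‖ ≤ ε ∧ qf T (d + v) = 0 := by
  unfold BddBel at hu
  push Not at hu
  obtain ⟨C, hC⟩ : ∃ C, C = (|qf T d| + 2 * ε * ‖T d‖) / ε ^ 2 := ⟨_, rfl⟩
  obtain ⟨w, hw⟩ := hu (-C)
  rw [qf_neg] at hw
  have hw0 : 0 < ‖(w : H)‖ := by
    rw [norm_pos_iff]
    intro h
    have : w = 0 := by exact_mod_cast h
    subst this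
    simp [qf] at hw
  obtain ⟨u, hu⟩ : ∃ u, u = ((‖(w : H)‖⁻¹ : ℝ) : ℂ) • w := ⟨_, rfl⟩
  have hu1 : ‖(u : H)‖ = 1 := by
    rw [hu, Submodule.coe_smul, norm_smul]; simp; field_simp
  have hqu : C < qf T u := by
    rw [hu, qf_smul, inv_pow, lt_inv_mul_iff₀ (by positivity)]
    linarith
  have hf : ∀ t : ℝ, qf T (d + (t : ℂ) • u) =
      qf T d + t ^ 2 * qf T u + 2 * (t * (inner ℂ (T d) (u : H) : ℂ).re) := by
    intro t
    rw [qf_add hs, qf_smul]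
    simp only [Submodule.coe_smul, inner_smul_right, Complex.re_ofReal_mul]
  have hcont : Continuous fun t : ℝ => qf T (d + (t : ℂ) • u) := by
    simp only [hf]; fun_prop
  have hr : |(inner ℂ (T d) (u : H) : ℂ).re| ≤ ‖T d‖ := by
    refine (Complex.abs_re_le_norm _).trans ((norm_inner_le_norm _ _).trans ?_)
    rw [hu1, mul_one]
  have hpos : 0 ≤ qf T (d + (ε : ℂ) • u) := by
    rw [hf]
    have h1 : ε ^ 2 * C = |qf T d| + 2 * ε * ‖T d‖ := by rw [hC]; field_simp
    have h2 : ε ^ 2 * C ≤ ε ^ 2 * qf T u := by gcongr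
    have h3 := mul_le_mul_of_nonneg_left (abs_le.mp hr).1 hε.le
    linarith [neg_abs_le (qf T d)]
  have hzero : qf T (d + ((0 : ℝ) : ℂ) • u) ≤ 0 := by simpa using hd
  obtain ⟨t, ht, h0⟩ := intermediate_value_Icc hε.le hcont.continuousOn ⟨hzero, hpos⟩
  refine ⟨(t : ℂ) • u, ?_, h0⟩
  rw [Submodule.coe_smul, norm_smul, hu1, Complex.norm_real, Real.norm_of_nonneg ht.1]
  linarith [ht.2]

omit [CompleteSpace H] in
lemma unbdd_step' (hs : ∀ x y : D, (inner ℂ (T x) (y : H) : ℂ) = inner ℂ (x : H) (T y))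
    (hu : ¬ BddBel (-T)) (hu2 : ¬ BddBel T) (d : D) (ε : ℝ) (hε : 0 < ε) :
    ∃ v : D, ‖(v : H)‖ ≤ ε ∧ qf T (d + v) = 0 := by
  rcases le_total (qf T d) 0 with h | h
  · exact unbdd_step hs hu d h ε hε
  · obtain ⟨v, h1, h2⟩ := unbdd_step (T := -T) (by intro x y; simp [hs]) (by simpa using hu2) d
      (by rw [qf_neg]; linarith) ε hε
    exact ⟨v, h1, by rw [qf_neg] at h2; linarith⟩

lemma exists_on (hinf : ¬FiniteDimensional ℂ H) (hD : Dense (D : Set H)) :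
    ∃ e : ℕ → D, Orthonormal ℂ e := by
  have hDinf : ¬ FiniteDimensional ℂ D := by
    intro h
    have hc : IsClosed (D : Set H) := D.closed_of_finiteDimensional
    have : D = ⊤ := by
      rw [← SetLike.coe_set_eq, Submodule.top_coe, ← hD.closure_eq, hc.closure_eq]
    subst this
    exact hinf (LinearEquiv.finiteDimensional (Submodule.topEquiv (R := ℂ) (M := H)))
  let b := Module.Basis.ofVectorSpace ℂ D
  have : Infinite (Module.Basis.ofVectorSpaceIndex ℂ D) := by
    by_contra h
    rw [not_infinite_iff_finite] at h
    exact hDinf (Module.Finite.of_basis b)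
  let f := Infinite.natEmbedding (Module.Basis.ofVectorSpaceIndex ℂ D)
  have hl : LinearIndependent ℂ (fun n => b (f n)) := b.linearIndependent.comp f f.injective
  exact ⟨_, InnerProductSpace.gramSchmidtNormed_orthonormal hl⟩

lemma on_weakNull (e : ℕ → D) (he : Orthonormal ℂ e) : WeakNull fun n => (e n : H) := by
  have he' : Orthonormal ℂ fun n => (e n : H) := he.comp_linearIsometry D.subtypeₗᵢ
  intro y
  have := (he'.inner_products_summable y).tendsto_atTop_zero
  rw [tendsto_zero_iff_norm_tendsto_zero]
  have h2 := this.sqrt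
  simpa using h2

/-- the essential numerical range, on a fixed domain -/
def InWe (T : D →ₗ[ℂ] H) (z : ℂ) : Prop :=
  ∃ x : ℕ → D, (∀ n, ‖((x n : H))‖ = 1) ∧ WeakNull (fun n => ((x n : H))) ∧
    Tendsto (fun n => (inner ℂ ((x n : H)) (T (x n)) : ℂ)) atTop (nhds z)

lemma BddBel.of_shift {c : ℝ} (h : BddBel (shiftOp T c)) : BddBel T := by
  obtain ⟨a, ha⟩ := h
  refine ⟨a - c, fun x => ?_⟩
  have := ha x
  rw [qf_shift] at this
  linarith

lemma BddBel.of_neg_shift {c : ℝ} (h : BddBel (-shiftOp T c)) : BddBel (-T) := by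
  obtain ⟨a, ha⟩ := h
  refine ⟨a + c, fun x => ?_⟩
  have := ha x
  rw [qf_neg, qf_shift] at this
  rw [qf_neg]
  linarith

lemma unbdd_inWe (hinf : ¬FiniteDimensional ℂ H) (hD : Dense (D : Set H))
    (hs : ∀ x y : D, (inner ℂ (T x) (y : H) : ℂ) = inner ℂ (x : H) (T y))
    (hu : ¬ BddBel (-T)) (hu2 : ¬ BddBel T) (lam : ℝ) : InWe T lam := by
  obtain ⟨e, he⟩ := exists_on hinf hD
  have hew := on_weakNull e he
  have hpos : ∀ n : ℕ, 0 < (1 / 2 : ℝ) * (1 / ((n : ℝ) + 1)) := fun n => by positivity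
  choose v hv1 hv2 using fun n : ℕ => unbdd_step' (shift_symm hs (-lam))
    (fun h => hu h.of_neg_shift) (fun h => hu2 h.of_shift) (e n) _ (hpos n)
  have hv0 : Tendsto (fun n => (v n : H)) atTop (nhds 0) := by
    refine squeeze_zero_norm hv1 ?_
    simpa using (tendsto_one_div_add_atTop_nhds_zero_nat (𝕜 := ℝ)).const_mul (1 / 2 : ℝ)
  have hvh : ∀ n, ‖(v n : H)‖ ≤ 1 / 2 := fun n => (hv1 n).trans (by
    have : 1 / ((n : ℝ) + 1) ≤ 1 := by rw [div_le_one (by positivity)]; simp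
    linarith)
  have hen : ∀ n, ‖(e n : H)‖ = 1 := fun n => he.1 n
  have hz : ∀ n, 1 / 2 ≤ ‖((e n + v n : D) : H)‖ := by
    intro n
    have := norm_sub_le ((e n : H) + v n) (v n : H)
    rw [add_sub_cancel_right, hen] at this
    rw [Submodule.coe_add]
    linarith [hvh n]
  have hzw : WeakNull fun n => ((e n + v n : D) : H) := by
    intro y
    have := (hew y).add (hv0.inner (tendsto_const_nhds (x := y)))
    simpa [inner_add_left] using this
  refine ⟨fun n => ((‖((e n + v n : D) : H)‖⁻¹ : ℝ) : ℂ) • (e n + v n), fun n => ?_, fun y => ?_, ?_⟩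
  · have := hz n
    have h0 : ‖((e n + v n : D) : H)‖ ≠ 0 := by linarith
    rw [Submodule.coe_smul, norm_smul, Complex.norm_real, norm_inv, norm_norm, inv_mul_cancel₀ h0]
  · have h1 := (hzw y).norm.const_mul 2
    rw [norm_zero, mul_zero] at h1
    refine squeeze_zero_norm (fun n => ?_) h1
    beta_reduce
    rw [Submodule.coe_smul, inner_smul_left, norm_mul, Complex.conj_ofReal, Complex.norm_real,
      norm_inv, norm_norm]
    gcongr
    rw [inv_le_comm₀ (by linarith [hz n]) (by norm_num)]
    linarith [hz n]
  · refine tendsto_const_nhds.congr fun n => ?_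
    have h := hv2 n
    have hz0 := hz n
    rw [qf_shift] at h
    rw [qf_im hs, qf_smul]
    congr 1
    have h0 : ‖((e n + v n : D) : H)‖ ≠ 0 := by linarith
    have : qf T (e n + v n) = lam * ‖((e n + v n : D) : H)‖ ^ 2 := by linarith
    rw [this]; field_simp

lemma inWe_real (hs : ∀ x y : D, (inner ℂ (T x) (y : H) : ℂ) = inner ℂ (x : H) (T y)) {z : ℂ}
    (h : InWe T z) : ∃ lam : ℝ, z = lam := by
  obtain ⟨x, -, -, h⟩ := h
  refine ⟨z.re, ?_⟩
  have h2 := (Complex.continuous_im.tendsto z).comp h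
  have h3 : z.im = 0 := by
    refine tendsto_nhds_unique h2 (tendsto_const_nhds.congr fun n => ?_)
    simp [qf_im hs]
  exact Complex.ext rfl (by simp [h3])

lemma inWe_incl (hinf : ¬FiniteDimensional ℂ H) (hT : SAOp D T) (hS : RCOp D S T) {z : ℂ}
    (h : InWe T z) : InWe (T + S) z := by
  have hA := hT.perturb hS
  have fin : ∀ x : ℕ → D, (∀ n, ‖((x n : H))‖ = 1) → WeakNull (fun n => ((x n : H))) →
      Tendsto (fun n => (inner ℂ ((x n : H)) (T (x n)) : ℂ)) atTop (nhds z) →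
      Tendsto (fun n => qf S (x n)) atTop (nhds 0) → InWe (T + S) z := by
    intro x h1 h2 h3 h4
    refine ⟨x, h1, h2, ?_⟩
    have h5 := h3.add ((Complex.continuous_ofReal.tendsto _).comp h4)
    simp only [Complex.ofReal_zero, add_zero] at h5
    refine h5.congr fun n => ?_
    simp [inner_add_right, qf_im hS.symm]
  by_cases hb : BddBel T
  · obtain ⟨x, h1, h2, h3⟩ := h
    obtain ⟨C, hC⟩ := ((Complex.continuous_re.tendsto z).comp h3).bddAbove_range
    exact fin x h1 h2 h3 (form_null' hT hS hb x h2 h1 C fun n => hC ⟨n, rfl⟩)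
  by_cases hb2 : BddBel (-T)
  · obtain ⟨x, h1, h2, h3⟩ := h
    obtain ⟨C, hC⟩ := ((Complex.continuous_re.tendsto z).comp h3).bddBelow_range
    exact fin x h1 h2 h3 (form_null' hT.neg hS.neg_right hb2 x h2 h1 (-C) fun n => by
      rw [qf_neg]; exact neg_le_neg (hC ⟨n, rfl⟩))
  obtain ⟨lam, rfl⟩ := inWe_real hT.symm h
  have hB := hS.perturb hT.dense
  refine unbdd_inWe hinf hT.dense hA.symm (fun h => hb2 ?_) (fun h => hb ?_) lam
  · have := h.perturb hA.neg hB.neg_left.neg_right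
    simpa using this
  · have := h.perturb hA hB
    simpa using this

/-- Proposition 4.3: if `T` is selfadjoint and `S` is symmetric and `T`-compact,
then `W_e(T) = W_e(T + S)` (where `T + S` has domain `dom T`, since
`dom T ⊆ dom S` so that `dom T ∩ dom S = dom T`). -/
theorem essNumRange_eq_of_symmetric_relCompact_perturbation
    [TopologicalSpace.SeparableSpace H] (hinf : ¬FiniteDimensional ℂ H)
    (T S : H →ₗ.[ℂ] H) (hdense : Dense (T.domain : Set H)) (hsa : T.adjoint = T)
    (hsym : IsSymmetricP S) (hcomp : RelCompactP S T) :
    essNumRange T = essNumRange (pmapAdd T S) := by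
  obtain ⟨hdom, hc⟩ := hcomp
  let D := T.domain
  let T0 : D →ₗ[ℂ] H := T.toFun
  let S0 : D →ₗ[ℂ] H := S.toFun ∘ₗ Submodule.inclusion hdom
  have hfa := T.adjoint_isFormalAdjoint hdense
  have hsymT : ∀ x y : T.domain, (inner ℂ (T x) (y : H) : ℂ) = inner ℂ (x : H) (T y) := by
    rw [hsa] at hfa
    exact fun x y => hfa x y
  have hT : SAOp D T0 := by
    refine ⟨hdense, hsymT, fun y z h => ?_⟩
    have hy : y ∈ T.adjoint.domain := by
      refine LinearPMap.mem_adjoint_domain_of_exists y ⟨z, fun x => ?_⟩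
      rw [← inner_conj_symm, ← inner_conj_symm y]
      exact congrArg _ (h x).symm
    have hz : T.adjoint ⟨y, hy⟩ = z := by
      refine LinearPMap.adjoint_apply_eq hdense ⟨y, hy⟩ fun x => ?_
      rw [← inner_conj_symm, ← inner_conj_symm y]
      exact congrArg _ (h x).symm
    have key : ∀ A : H →ₗ.[ℂ] H, A = T → ∀ hA : y ∈ A.domain, A ⟨y, hA⟩ = z →
        ∃ h : y ∈ D, T0 ⟨y, h⟩ = z := by
      rintro A rfl hA e
      exact ⟨hA, e⟩
    exact key _ hsa hy hz
  have hS : RCOp D S0 T0 := ⟨fun x y => hsym (Submodule.inclusion hdom x) (Submodule.inclusion hdom y), hc⟩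
  have e1 : ∀ z, z ∈ essNumRange T ↔ InWe T0 z := fun z => Iff.rfl
  have e2 : ∀ z, z ∈ essNumRange (pmapAdd T S) ↔ InWe (T0 + S0) z := by
    intro z
    constructor
    · rintro ⟨x, h1, h2, h3⟩
      exact ⟨fun n => ⟨x n, (x n).2.1⟩, h1, h2, h3⟩
    · rintro ⟨x, h1, h2, h3⟩
      exact ⟨fun n => ⟨x n, (x n).2, hdom (x n).2⟩, h1, h2, h3⟩
  ext z
  rw [e1, e2]
  refine ⟨inWe_incl hinf hT hS, fun h => ?_⟩
  have := inWe_incl hinf (hT.perturb hS) (hS.perturb hdense) h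
  simpa using this
end
end
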